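/- For any canonical module ω_R of R, the socle Hom_R(𝕜, H^{m+n−2}_I(ω_R)) is an infinite-dimensional 𝕜-vector space. -/

import Mathlib

open CategoryTheory Opposite MvPowerSeries

set_option synthInstance.maxHeartbeats 1000000
set_option maxHeartbeats 1000000

noncomputable section

/-- The grade of an ideal: the maximal length of a regular sequence contained in it. -/
def idealGrade {A : Type} [CommRing A] (J : Ideal A) : ℕ∞ :=
  sSup {c : ℕ∞ | ∃ rs : List A, (∀ r ∈ rs, r ∈ J) ∧
    RingTheory.Sequence.IsRegular A rs ∧ (rs.length : ℕ∞) = c}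

/-- The height of an ideal: the infimum of heights of primes containing it. -/
def idealHeight {A : Type} [CommRing A] (J : Ideal A) : ℕ∞ :=
  sInf {h : ℕ∞ | ∃ p : PrimeSpectrum A, J ≤ p.asIdeal ∧ Order.height p = h}

/-- A canonical module of a `d`-dimensional local ring `A`: a finitely generated module `ω`
with `Ext_A^i(𝕜, ω) = 0` for `i ≠ d` and `Ext_A^d(𝕜, ω)` a one-dimensional `𝕜`-vector space
(equivalently, isomorphic to `𝕜` as an `A`-module), where `𝕜` is the residue field. -/
def IsCanonicalModule (A : Type) [CommRing A] [IsLocalRing A] (d : ℕ)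
    (ω : ModuleCat A) : Prop :=
  Module.Finite A ω ∧
  (∀ i : ℕ, i ≠ d → Subsingleton
    (((Ext A (ModuleCat A) i).obj
      (op (ModuleCat.of A (IsLocalRing.ResidueField A)))).obj ω)) ∧
  Nonempty ((((Ext A (ModuleCat A) d).obj
      (op (ModuleCat.of A (IsLocalRing.ResidueField A)))).obj ω)
    ≃ₗ[A] IsLocalRing.ResidueField A)

variable (𝕜 : Type) [Field 𝕜] (m n : ℕ)

/-- The formal power series ring `P` in the entries of an `m × n` matrix of variables. -/
abbrev DetP := MvPowerSeries (Fin m × Fin n) 𝕜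

/-- The ideal of `P` generated by the `2 × 2` minors of the matrix of variables. -/
def detI2 : Ideal (DetP 𝕜 m n) :=
  Ideal.span {f | ∃ (i k : Fin m) (j l : Fin n), i < k ∧ j < l ∧
    f = X (i, j) * X (k, l) - X (i, l) * X (k, j)}

/-- The complete determinantal ring `R = P/I₂(X)`. -/
abbrev DetR := DetP 𝕜 m n ⧸ detI2 𝕜 m n

/-- The residue class in `R` of the variable `x_{ij}`. -/
def detx (i : Fin m) (j : Fin n) : DetR 𝕜 m n :=
  Ideal.Quotient.mk (detI2 𝕜 m n) (X (i, j))

/-- The ideal `I` of `R` generated by the entries of the first `n - 1` columns. -/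
def detJ : Ideal (DetR 𝕜 m n) :=
  Ideal.span {x | ∃ (i : Fin m) (j : Fin n), (j : ℕ) < n - 1 ∧ x = detx 𝕜 m n i j}

/-- The formal power series ring `S = 𝕜[[x_1, …, x_m, a_1, …, a_{n-1}]]`. -/
abbrev DetS := MvPowerSeries (Fin m ⊕ Fin (n - 1)) 𝕜

/-- The ideal `𝔞 = (a_1, …, a_{n-1})S`. -/
def detA : Ideal (DetS 𝕜 m n) :=
  Ideal.span {f | ∃ j : Fin (n - 1), f = X (Sum.inr j)}

/-- The property pinning down the local `𝕜`-algebra homomorphism `φ : R → S`: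
`x_{ij} ↦ a_j·x_i` for `1 ≤ j ≤ n-1` and `x_{in} ↦ x_i` (in `0`-based indexing, the last
column is `j = n-1`).  Any `𝕜`-algebra homomorphism `R → S` with these values on the
variables automatically maps the maximal ideal into the maximal ideal, hence is continuous
and is uniquely determined by these values; so this predicate characterizes `φ`. -/
def IsDetPhi (φ : DetR 𝕜 m n →ₐ[𝕜] DetS 𝕜 m n) : Prop :=
  ∀ (i : Fin m) (j : Fin n),
    φ (detx 𝕜 m n i j) =
      if h : (j : ℕ) < n - 1 then X (Sum.inr (⟨j, h⟩ : Fin (n - 1))) * X (Sum.inl i)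
      else X (Sum.inl i)

lemma LinearMap.exists_equiv_of_ker_eq {A Z M N : Type*} [Ring A] [AddCommGroup Z] [AddCommGroup M]
    [AddCommGroup N] [Module A Z] [Module A M] [Module A N] (f : Z →ₗ[A] M) (g : Z →ₗ[A] N)
    (hf : Function.Surjective f) (hg : Function.Surjective g)
    (h : LinearMap.ker f = LinearMap.ker g) : ∃ e : M ≃ₗ[A] N, ∀ z, e (f z) = g z := by
  refine ⟨(f.quotKerEquivOfSurjective hf).symm ≪≫ₗ Submodule.quotEquivOfEq _ _ h ≪≫ₗ
    g.quotKerEquivOfSurjective hg, fun z => ?_⟩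
  have : (f.quotKerEquivOfSurjective hf).symm (f z) = Submodule.Quotient.mk z := by
    rw [LinearEquiv.symm_apply_eq]; rfl
  simp only [LinearEquiv.trans_apply, this]
  rfl

section
variable {A : Type} [CommRing A] (Y : ModuleCat.{0} A)

lemma homologyπ_ker {ι : Type} {c : ComplexShape ι} (K : HomologicalComplex (ModuleCat.{0} A) c)
    (i j : ι) (hij : c.prev j = i) (z : K.cycles j) :
    K.homologyπ j z = 0 ↔ ∃ g : K.X i, K.d i j g = K.iCycles j z := by
  have hex : (ShortComplex.mk (K.toCycles i j) (K.homologyπ j) (by simp)).Exact :=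
    ShortComplex.exact_of_g_is_cokernel _ (K.homologyIsCokernel i j hij)
  rw [ShortComplex.moduleCat_exact_iff] at hex
  constructor
  · intro h
    obtain ⟨g, hg⟩ := hex z h
    refine ⟨g, ?_⟩
    dsimp at hg
    rw [← hg, ← ConcreteCategory.comp_apply, K.toCycles_i]
  · rintro ⟨g, hg⟩
    have : K.toCycles i j g = z := by
      apply (ModuleCat.mono_iff_injective (K.iCycles j)).1 inferInstance
      rw [← ConcreteCategory.comp_apply, K.toCycles_i, hg]
    rw [← this, ← ConcreteCategory.comp_apply, K.toCycles_comp_homologyπ]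
    rfl

lemma exists_iCycles {ι : Type} {c : ComplexShape ι} (K : HomologicalComplex (ModuleCat.{0} A) c)
    (i j : ι) (hij : c.next i = j) (f : K.X i) (hf : K.d i j f = 0) :
    ∃ z : K.cycles i, K.iCycles i z = f := by
  have hex : (ShortComplex.mk (K.iCycles i) (K.d i j) (by simp)).Exact :=
    ShortComplex.exact_of_f_is_kernel _ (K.cyclesIsKernel i j hij)
  rw [ShortComplex.moduleCat_exact_iff] at hex
  exact hex f hf

variable {X : ModuleCat.{0} A} (P : ProjectiveResolution X)

lemma d_comp_iCycles (n : ℕ) (z : (P.complex.linearYonedaObj A Y).cycles n) :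
    P.complex.d (n + 1) n ≫ (show P.complex.X n ⟶ Y from
      (P.complex.linearYonedaObj A Y).iCycles n z) = 0 :=
  congrArg (fun f => f.hom z) ((P.complex.linearYonedaObj A Y).iCycles_d n (n + 1))

lemma extMk_smul (n : ℕ) (f : P.complex.X n ⟶ Y) (hf : P.complex.d (n + 1) n ≫ f = 0) (r : A) :
    P.extMk (r • f) (n + 1) rfl (by simp [hf]) = r • P.extMk f (n + 1) rfl hf := by
  rw [Abelian.Ext.smul_eq_comp_mk₀, P.extMk_comp_mk₀]
  congr 1

lemma extMk_congr {n : ℕ} {f g : P.complex.X n ⟶ Y} (h : f = g)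
    (hf : P.complex.d (n + 1) n ≫ f = 0) (hg : P.complex.d (n + 1) n ≫ g = 0) :
    P.extMk f (n + 1) rfl hf = P.extMk g (n + 1) rfl hg := by
  subst h; rfl

/-- The class in `Ext` of a cocycle of the complex of morphisms out of a projective resolution. -/
def cyclesToExt (n : ℕ) :
    (P.complex.linearYonedaObj A Y).cycles n →ₗ[A] Abelian.Ext X Y n where
  toFun z := P.extMk ((P.complex.linearYonedaObj A Y).iCycles n z) (n + 1) rfl
    (d_comp_iCycles Y P n z)
  map_add' z w := by
    refine Eq.trans (extMk_congr Y P ?_ _ ?_) (P.add_extMk _ _ (n + 1) rfl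
      (d_comp_iCycles Y P n z) (d_comp_iCycles Y P n w)).symm
    · exact map_add ((P.complex.linearYonedaObj A Y).iCycles n).hom z w
    · rw [Preadditive.comp_add]
      exact (congrArg₂ (· + ·) (d_comp_iCycles Y P n z) (d_comp_iCycles Y P n w)).trans
        (add_zero 0)
  map_smul' r z := by
    refine Eq.trans (extMk_congr Y P ?_ _ ?_) (extMk_smul Y P n _ (d_comp_iCycles Y P n z) r)
    · exact map_smul ((P.complex.linearYonedaObj A Y).iCycles n).hom r z
    · rw [Linear.comp_smul]
      exact (congrArg (r • ·) (d_comp_iCycles Y P n z)).trans (smul_zero r)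

lemma cyclesToExt_surjective (n : ℕ) : Function.Surjective (cyclesToExt Y P n) := by
  intro x
  obtain ⟨f, hf, rfl⟩ := P.extMk_surjective x (n + 1) rfl
  obtain ⟨z, hz⟩ := exists_iCycles (P.complex.linearYonedaObj A Y) n (n + 1) (by simp) f hf
  exact ⟨z, extMk_congr Y P hz (d_comp_iCycles Y P n z) hf⟩

lemma cyclesToExt_ker (p : ℕ) : LinearMap.ker (cyclesToExt Y P (p + 1)) =
    LinearMap.ker ((P.complex.linearYonedaObj A Y).homologyπ (p + 1)).hom := by
  ext z
  rw [LinearMap.mem_ker, LinearMap.mem_ker]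
  refine (P.extMk_eq_zero_iff _ _ rfl (d_comp_iCycles Y P (p + 1) z) p rfl).trans ?_
  exact (homologyπ_ker _ p (p + 1) (by simp) z).symm

lemma exists_homology_equiv (p : ℕ) :
    ∃ e : (P.complex.linearYonedaObj A Y).homology (p + 1) ≃ₗ[A] Abelian.Ext X Y (p + 1),
      ∀ z, e ((P.complex.linearYonedaObj A Y).homologyπ (p + 1) z) = cyclesToExt Y P (p + 1) z :=
  LinearMap.exists_equiv_of_ker_eq _ _
    ((ModuleCat.epi_iff_surjective _).1 inferInstance)
    (cyclesToExt_surjective Y P _) (cyclesToExt_ker Y P p).symm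

variable {X' : ModuleCat.{0} A} {P' : ProjectiveResolution X'} {P}

/-- Precomposition with a chain map, as a map of complexes of morphisms into `Y`. -/
def linearYonedaMap (φ : P'.complex ⟶ P.complex) :
    P.complex.linearYonedaObj A Y ⟶ P'.complex.linearYonedaObj A Y :=
  (HomologicalComplex.unopFunctor _ _).map
    ((((linearYoneda A (ModuleCat.{0} A)).obj Y).rightOp.mapHomologicalComplex _).map φ).op

lemma isoExt_naturality (g : X' ⟶ X) (φ : ProjectiveResolution.Hom P' P g) (n : ℕ) :
    ((Ext A (ModuleCat.{0} A) n).map g.op).app Y ≫ (P'.isoExt n Y).hom =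
      (P.isoExt n Y).hom ≫ HomologicalComplex.homologyMap (linearYonedaMap Y φ.hom) n := by
  have h1 := ProjectiveResolution.isoLeftDerivedObj_hom_naturality g P' P φ.hom
    (by simpa using φ.hom_f_zero_comp_π_f_zero) ((linearYoneda A (ModuleCat.{0} A)).obj Y).rightOp n
  have h2 := HomologicalComplex.homologyOp_hom_naturality (linearYonedaMap Y φ.hom) n
  have h1' := (congrArg Quiver.Hom.unop
    ((Iso.eq_inv_comp _).2 ((Category.assoc _ _ _).symm.trans ((Iso.comp_inv_eq _).2 h1.symm)))).symm
  have h2' := congrArg Quiver.Hom.unop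
    ((Iso.eq_inv_comp _).2 ((Category.assoc _ _ _).symm.trans ((Iso.comp_inv_eq _).2 h2.symm)))
  refine (Category.assoc _ _ _).symm.trans (Eq.trans (congrArg (· ≫ _) h1') ?_)
  refine (Category.assoc _ _ _).trans (Eq.trans (congrArg (_ ≫ ·) h2'.symm) ?_)
  exact (Category.assoc _ _ _).symm

lemma cyclesToExt_naturality (g : X' ⟶ X) (φ : ProjectiveResolution.Hom P' P g) (n : ℕ)
    (z : (P.complex.linearYonedaObj A Y).cycles n) :
    (Abelian.Ext.mk₀ g).comp (cyclesToExt Y P n z) (zero_add n) =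
     cyclesToExt Y P' n (HomologicalComplex.cyclesMap (linearYonedaMap Y φ.hom) n z) := by
  refine (ProjectiveResolution.mk₀_comp_extMk _ (n + 1) rfl (d_comp_iCycles Y P n z) φ).trans ?_
  refine extMk_congr Y P' ?_ _ (d_comp_iCycles Y P' n _)
  exact (congrArg (fun f => f.hom z)
    (HomologicalComplex.cyclesMap_i (linearYonedaMap Y φ.hom) n)).symm

/-- The derived functor definition of `Ext` agrees with the one by morphisms in the derived
category, naturally in the first variable. -/
lemma exists_ext_equiv (p : ℕ) :
    ∃ e : ∀ X : ModuleCat.{0} A, ((Ext A (ModuleCat.{0} A) (p + 1)).obj (op X)).obj Y ≃ₗ[A]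
      Abelian.Ext X Y (p + 1), ∀ (X' X : ModuleCat.{0} A) (g : X' ⟶ X)
        (z : ((Ext A (ModuleCat.{0} A) (p + 1)).obj (op X)).obj Y),
        e X' (((Ext A (ModuleCat.{0} A) (p + 1)).map g.op).app Y z) =
          (Abelian.Ext.mk₀ g).comp (e X z) (zero_add _) := by
  choose e he using fun X : ModuleCat.{0} A =>
    exists_homology_equiv Y (projectiveResolution X) p
  refine ⟨fun X => ((projectiveResolution X).isoExt (p + 1) Y).toLinearEquiv ≪≫ₗ e X, ?_⟩
  intro X' X g z
  obtain ⟨w, hw⟩ := (ModuleCat.epi_iff_surjective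
    (((projectiveResolution X).complex.linearYonedaObj A Y).homologyπ (p + 1))).1 inferInstance
    (((projectiveResolution X).isoExt (p + 1) Y).hom z)
  let φ : ProjectiveResolution.Hom (projectiveResolution X') (projectiveResolution X) g :=
    ⟨ProjectiveResolution.lift g _ _, (ProjectiveResolution.lift_commutes_zero g
      (projectiveResolution X') (projectiveResolution X)).trans (by simp)⟩
  have h1 := congrArg (fun f => f.hom z) (isoExt_naturality Y g φ (p + 1))
  dsimp at h1
  simp only [LinearEquiv.trans_apply]
  change e X' (((projectiveResolution X').isoExt (p + 1) Y).hom _) =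
    (Abelian.Ext.mk₀ g).comp (e X (((projectiveResolution X).isoExt (p + 1) Y).hom z)) _
  rw [← hw, he, cyclesToExt_naturality Y g φ, ← he]
  congr 1
  refine h1.trans ?_
  change HomologicalComplex.homologyMap (linearYonedaMap Y φ.hom) (p + 1)
    (((projectiveResolution X).isoExt (p + 1) Y).hom z) = _
  rw [← hw]
  exact congrArg (fun f => f.hom w)
    (HomologicalComplex.homologyπ_naturality (linearYonedaMap Y φ.hom) (p + 1))

end

section extFunctoriality

variable {A : Type} [CommRing A] (ω : ModuleCat.{0} A)
  {M N Q : Type} [AddCommGroup M] [AddCommGroup N] [AddCommGroup Q]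
  [Module A M] [Module A N] [Module A Q]

variable (M) in
/-- The module `Ext^i(M, ω)`. -/
abbrev extTo (i : ℕ) : Type := Abelian.Ext (ModuleCat.of A M) ω i

/-- The map `Ext^i(N, ω) → Ext^i(M, ω)` induced by a linear map `M → N`. -/
def extMap (i : ℕ) (f : M →ₗ[A] N) : extTo ω N i →ₗ[A] extTo ω M i :=
  (Abelian.Ext.mk₀ (ModuleCat.ofHom f)).precompOfLinear A ω (zero_add i)

lemma extMap_apply (i : ℕ) (f : M →ₗ[A] N) (x : extTo ω N i) :
    extMap ω i f x = (Abelian.Ext.mk₀ (ModuleCat.ofHom f)).comp x (zero_add i) := rfl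

lemma extMap_id (i : ℕ) (x : extTo ω M i) : extMap ω i LinearMap.id x = x := by
  rw [extMap_apply, ModuleCat.ofHom_id, Abelian.Ext.mk₀_id_comp]

lemma extMap_comp (i : ℕ) (f : M →ₗ[A] N) (g : N →ₗ[A] Q) (x : extTo ω Q i) :
    extMap ω i (g ∘ₗ f) x = extMap ω i f (extMap ω i g x) := by
  simp only [extMap_apply]
  rw [ModuleCat.ofHom_comp, Abelian.Ext.mk₀_comp_mk₀_assoc]

lemma extMap_zero (i : ℕ) (x : extTo ω N i) : extMap ω i (0 : M →ₗ[A] N) x = 0 := by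
  rw [extMap_apply, show ModuleCat.ofHom (0 : M →ₗ[A] N) = 0 from rfl, Abelian.Ext.mk₀_zero,
    Abelian.Ext.zero_comp]

lemma extMap_smul_id (i : ℕ) (r : A) (x : extTo ω M i) :
    extMap ω i (r • (LinearMap.id : M →ₗ[A] M)) x = r • x := by
  rw [extMap_apply, show ModuleCat.ofHom (r • (LinearMap.id : M →ₗ[A] M)) =
    r • 𝟙 (ModuleCat.of A M) from rfl, Abelian.Ext.mk₀_smul, Abelian.Ext.smul_comp,
    Abelian.Ext.mk₀_id_comp]

lemma extTo_subsingleton_of_equiv (i : ℕ) (e : M ≃ₗ[A] N) [Subsingleton (extTo ω M i)] :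
    Subsingleton (extTo ω N i) := by
  refine ⟨fun x y => ?_⟩
  have key : ∀ z : extTo ω N i, extMap ω i (e.symm : N →ₗ[A] M) (extMap ω i (e : M →ₗ[A] N) z) = z := by
    intro z
    rw [← extMap_comp, LinearEquiv.comp_symm, extMap_id]
  rw [← key x, ← key y]
  congr 1
  exact Subsingleton.elim _ _

lemma extTo_subsingleton_of_subsingleton (i : ℕ) [Subsingleton M] :
    Subsingleton (extTo ω M i) := by
  refine ⟨fun x y => ?_⟩
  rw [← extMap_id ω i x, ← extMap_id ω i y, Subsingleton.elim (LinearMap.id : M →ₗ[A] M) 0,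
    extMap_zero, extMap_zero]

/-- A short exact sequence of linear maps as a short exact sequence in the category of modules. -/
abbrev shortComplexOfLinear (f : M →ₗ[A] N) (g : N →ₗ[A] Q) (h : Function.Exact f g) :
    ShortComplex (ModuleCat.{0} A) :=
  ShortComplex.mk (ModuleCat.ofHom f) (ModuleCat.ofHom g)
    (by rw [← ModuleCat.ofHom_comp, h.linearMap_comp_eq_zero]; rfl)

lemma shortExact_of_linear (f : M →ₗ[A] N) (g : N →ₗ[A] Q) (h : Function.Exact f g)
    (hf : Function.Injective f) (hg : Function.Surjective g) :
    (shortComplexOfLinear f g h).ShortExact :=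
  ModuleCat.shortComplex_shortExact _ h hf hg

variable {ω}

lemma extTo_subsingleton_of_exact (i : ℕ) {f : M →ₗ[A] N} {g : N →ₗ[A] Q}
    (h : Function.Exact f g) (hf : Function.Injective f) (hg : Function.Surjective g)
    [Subsingleton (extTo ω M i)] [Subsingleton (extTo ω Q i)] : Subsingleton (extTo ω N i) := by
  refine subsingleton_of_forall_eq 0 fun x => ?_
  obtain ⟨y, rfl⟩ := Abelian.Ext.contravariant_sequence_exact₂ (shortExact_of_linear f g h hf hg)
    ω x (Subsingleton.elim (α := extTo ω M i) _ _)
  rw [Subsingleton.elim (α := extTo ω Q i) y 0, Abelian.Ext.comp_zero]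

lemma extMap_injective_of_exact (i : ℕ) {f : M →ₗ[A] N} {g : N →ₗ[A] Q}
    (h : Function.Exact f g) (hf : Function.Injective f) (hg : Function.Surjective g)
    [Subsingleton (extTo ω M i)] : Function.Injective (extMap ω (i + 1) g) := by
  rw [injective_iff_map_eq_zero]
  intro x hx
  obtain ⟨y, rfl⟩ := Abelian.Ext.contravariant_sequence_exact₃ (shortExact_of_linear f g h hf hg)
    ω x hx (add_comm 1 i)
  rw [Subsingleton.elim (α := extTo ω M i) y 0, Abelian.Ext.comp_zero]

lemma extMap_surjective_of_exact (i : ℕ) {f : M →ₗ[A] N} {g : N →ₗ[A] Q}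
    (h : Function.Exact f g) (hf : Function.Injective f) (hg : Function.Surjective g)
    [Subsingleton (extTo ω Q (i + 1))] : Function.Surjective (extMap ω i f) := fun x =>
  Abelian.Ext.contravariant_sequence_exact₁ (shortExact_of_linear f g h hf hg)
    ω x (add_comm 1 i) (Subsingleton.elim (α := extTo ω Q (i + 1)) _ _)

/-- The connecting map of `Ext`. -/
def extConn (ω : ModuleCat.{0} A) (i : ℕ) {f : M →ₗ[A] N} {g : N →ₗ[A] Q}
    (h : Function.Exact f g) (hf : Function.Injective f) (hg : Function.Surjective g) :
    extTo ω M i →ₗ[A] extTo ω Q (i + 1) :=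
  (shortExact_of_linear f g h hf hg).extClass.precompOfLinear A ω (add_comm 1 i)

lemma extConn_bijective (i : ℕ) {f : M →ₗ[A] N} {g : N →ₗ[A] Q}
    (h : Function.Exact f g) (hf : Function.Injective f) (hg : Function.Surjective g)
    [Subsingleton (extTo ω N i)] [Subsingleton (extTo ω N (i + 1))] :
    Function.Bijective (extConn ω i h hf hg) := by
  constructor
  · rw [injective_iff_map_eq_zero]
    intro x hx
    obtain ⟨y, rfl⟩ := Abelian.Ext.contravariant_sequence_exact₁
      (shortExact_of_linear f g h hf hg) ω x (add_comm 1 i) hx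
    rw [Subsingleton.elim (α := extTo ω N i) y 0, Abelian.Ext.comp_zero]
  · intro x
    exact Abelian.Ext.contravariant_sequence_exact₃ (shortExact_of_linear f g h hf hg)
      ω x (Subsingleton.elim (α := extTo ω N (i + 1)) _ _) (add_comm 1 i)

lemma extConn_naturality {M' N' Q' : Type} [AddCommGroup M'] [AddCommGroup N'] [AddCommGroup Q']
    [Module A M'] [Module A N'] [Module A Q'] (i : ℕ) {f : M →ₗ[A] N} {g : N →ₗ[A] Q}
    (h : Function.Exact f g) (hf : Function.Injective f) (hg : Function.Surjective g)
    {f' : M' →ₗ[A] N'} {g' : N' →ₗ[A] Q'}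
    (h' : Function.Exact f' g') (hf' : Function.Injective f') (hg' : Function.Surjective g')
    (u : M →ₗ[A] M') (v : N →ₗ[A] N') (w : Q →ₗ[A] Q') (huv : v ∘ₗ f = f' ∘ₗ u)
    (hvw : w ∘ₗ g = g' ∘ₗ v) (x : extTo ω M' i) :
    extConn ω i h hf hg (extMap ω i u x) = extMap ω (i + 1) w (extConn ω i h' hf' hg' x) := by
  have key := ShortComplex.ShortExact.extClass_naturality (shortExact_of_linear f g h hf hg)
    (shortExact_of_linear f' g' h' hf' hg')
    { τ₁ := ModuleCat.ofHom u
      τ₂ := ModuleCat.ofHom v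
      τ₃ := ModuleCat.ofHom w
      comm₁₂ := by
        dsimp
        rw [← ModuleCat.ofHom_comp, ← ModuleCat.ofHom_comp, huv]
      comm₂₃ := by
        dsimp
        rw [← ModuleCat.ofHom_comp, ← ModuleCat.ofHom_comp, hvw] }
  have h1 := congrArg (fun e => e.comp x (add_comm 1 i)) key
  dsimp at h1
  rw [Abelian.Ext.comp_assoc_of_second_deg_zero] at h1
  refine h1.trans ?_
  exact Abelian.Ext.comp_assoc _ _ _ (zero_add 1) (add_comm 1 i) (by lia)

end extFunctoriality

section localRing

variable {A : Type} [CommRing A] [IsLocalRing A] {ω : ModuleCat.{0} A}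

open IsLocalRing

lemma extTo_subsingleton_of_isFiniteLength (i : ℕ) [Subsingleton (extTo ω (ResidueField A) i)]
    {M : Type} [AddCommGroup M] [Module A M] (hM : IsFiniteLength A M) :
    Subsingleton (extTo ω M i) := by
  induction hM with
  | of_subsingleton => exact extTo_subsingleton_of_subsingleton ω i
  | @of_simple_quotient M _ _ N _ _ ih =>
    have : Subsingleton (extTo ω (M ⧸ N) i) := by
      obtain ⟨I, hI, ⟨e⟩⟩ := isSimpleModule_iff_quot_maximal.mp ‹IsSimpleModule A (M ⧸ N)›
      obtain rfl := eq_maximalIdeal hI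
      have : Subsingleton (extTo ω (A ⧸ maximalIdeal A) i) :=
        ‹Subsingleton (extTo ω (ResidueField A) i)›
      exact extTo_subsingleton_of_equiv ω i e.symm
    exact extTo_subsingleton_of_exact i (LinearMap.exact_subtype_mkQ N) N.injective_subtype
      N.mkQ_surjective

lemma extTo_subsingleton_of_smul_quotient [IsNoetherianRing A] [Module.Finite A ω] (i : ℕ)
    {M Q : Type} [AddCommGroup M] [Module A M] [Module.Finite A M] [AddCommGroup Q] [Module A Q]
    {x : A} (hx : x ∈ maximalIdeal A) (hxM : ∀ z : M, x • z = 0 → z = 0) (g : M →ₗ[A] Q)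
    (hg : Function.Surjective g) (hker : ∀ z, g z = 0 → ∃ y, x • y = z)
    (hker' : ∀ z, g (x • z) = 0)
    [Subsingleton (extTo ω Q (i + 1))] : Subsingleton (extTo ω M i) := by
  have hsurj : Function.Surjective (extMap ω i (x • (LinearMap.id : M →ₗ[A] M))) :=
    extMap_surjective_of_exact i (g := g)
      (fun z => ⟨hker z, by rintro ⟨y, rfl⟩; exact hker' y⟩)
      ((injective_iff_map_eq_zero _).2 hxM) hg
  have : (⊤ : Submodule A (extTo ω M i)) ≤ ⊥ := by
    refine Submodule.le_of_le_smul_of_le_jacobson_bot (I := maximalIdeal A) (Module.finite_def.1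
      (ModuleCat.finite_ext A _ ω i)) (maximalIdeal_le_jacobson _) ?_
    rintro z -
    obtain ⟨y, rfl⟩ := hsurj z
    rw [extMap_smul_id]
    exact Submodule.mem_sup_right (Submodule.smul_mem_smul hx trivial)
  refine subsingleton_of_forall_eq 0 fun z => ?_
  simpa using this (Submodule.mem_top (x := z))

end localRing

section stableInjection

open IsLocalRing

variable {A : Type} [CommRing A]

/-- The projection `A ⧸ J ^ s → A ⧸ J ^ t` for `t ≤ s`. -/
abbrev powTransition (J : Ideal A) {s t : ℕ} (h : t ≤ s) : (A ⧸ J ^ s) →ₗ[A] A ⧸ J ^ t :=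
  Submodule.mapQ _ _ LinearMap.id (Ideal.pow_le_pow_right h)

variable {S : Type} [CommRing S] [Algebra A S] {ω : ModuleCat.{0} A}

variable (A) in
/-- A power of an ideal of an algebra, as a submodule over the base ring. -/
abbrev powSubmodule (𝔞 : Ideal S) (t : ℕ) : Submodule A S := (𝔞 ^ t).restrictScalars A

variable (A) in
/-- The submodule of an algebra generated by the base ring and a power of an ideal. -/
abbrev basePowSubmodule (𝔞 : Ideal S) (t : ℕ) : Submodule A S :=
  LinearMap.range (Algebra.linearMap A S) ⊔ powSubmodule A 𝔞 t

lemma powSubmodule_le {𝔞 : Ideal S} {s t : ℕ} (h : t ≤ s) :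
    powSubmodule A 𝔞 s ≤ powSubmodule A 𝔞 t := fun _ hx => Ideal.pow_le_pow_right h hx

lemma exists_linearMap_extTo_stably_injective [IsLocalRing A] {J : Ideal A} {𝔞 : Ideal S} (p : ℕ)
    (hJ : ∀ t, (𝔞 ^ t).comap (algebraMap A S) = J ^ t)
    [Subsingleton (extTo ω (ResidueField A) (p + 1))]
    (hS : ∀ t, Subsingleton (extTo ω (S ⧸ powSubmodule A 𝔞 t) (p + 1)))
    (hS' : ∀ t, Subsingleton (extTo ω (S ⧸ powSubmodule A 𝔞 t) (p + 1 + 1)))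
    (hC : ∀ t, IsFiniteLength A (S ⧸ basePowSubmodule A 𝔞 t))
    {V : Type} [AddCommGroup V] [Module A V] (ρ : S →ₗ[A] V) (hρ : Function.Surjective ρ)
    (t : ℕ) (hρt : basePowSubmodule A 𝔞 t ≤ LinearMap.ker ρ) :
    ∃ L : extTo ω V (p + 1 + 1) →ₗ[A] extTo ω (A ⧸ J ^ t) (p + 1),
      ∀ s (hs : t ≤ s), Function.Injective (extMap ω (p + 1) (powTransition J hs) ∘ₗ L) := by
  have hle : ∀ s, J ^ s ≤ (powSubmodule A 𝔞 s).comap (Algebra.linearMap A S) := fun s x hx => by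
    rw [← hJ] at hx
    exact hx
  let f : ∀ s, (A ⧸ J ^ s) →ₗ[A] (S ⧸ powSubmodule A 𝔞 s) := fun s =>
    Submodule.mapQ _ _ (Algebra.linearMap A S) (hle s)
  let g : ∀ s, (S ⧸ powSubmodule A 𝔞 s) →ₗ[A] S ⧸ basePowSubmodule A 𝔞 s := fun s =>
    Submodule.mapQ _ _ LinearMap.id (le_sup_right : powSubmodule A 𝔞 s ≤ basePowSubmodule A 𝔞 s)
  have hf : ∀ s, Function.Injective (f s) := fun s => by
    rw [injective_iff_map_eq_zero]
    intro x hx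
    obtain ⟨x, rfl⟩ := Ideal.Quotient.mk_surjective x
    have hx' : algebraMap A S x ∈ 𝔞 ^ s := (Submodule.Quotient.mk_eq_zero _).1 hx
    rw [Ideal.Quotient.eq_zero_iff_mem, ← hJ]
    exact hx'
  have hg : ∀ s, Function.Surjective (g s) := fun s x => by
    obtain ⟨x, rfl⟩ := Submodule.Quotient.mk_surjective _ x
    exact ⟨Submodule.Quotient.mk x, rfl⟩
  have h : ∀ s, Function.Exact (f s) (g s) := fun s x => by
    obtain ⟨x, rfl⟩ := Submodule.Quotient.mk_surjective _ x
    constructor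
    · intro hx
      have hx' : x ∈ basePowSubmodule A 𝔞 s := (Submodule.Quotient.mk_eq_zero _).1 hx
      obtain ⟨_, ⟨y, rfl⟩, z, hz, rfl⟩ := Submodule.mem_sup.1 hx'
      refine ⟨Ideal.Quotient.mk _ y, ?_⟩
      refine (Submodule.Quotient.eq _).2 ?_
      simpa using hz
    · rintro ⟨y, hy⟩
      obtain ⟨y, rfl⟩ := Ideal.Quotient.mk_surjective y
      rw [← hy]
      exact (Submodule.Quotient.mk_eq_zero _).2 (Submodule.mem_sup_left ⟨y, rfl⟩)
  let u : ∀ s, t ≤ s → (S ⧸ powSubmodule A 𝔞 s) →ₗ[A] S ⧸ powSubmodule A 𝔞 t := fun s hs =>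
    Submodule.mapQ _ _ LinearMap.id (powSubmodule_le hs)
  let c : ∀ s, t ≤ s → (S ⧸ basePowSubmodule A 𝔞 s) →ₗ[A] S ⧸ basePowSubmodule A 𝔞 t :=
    fun s hs => Submodule.mapQ _ _ LinearMap.id (sup_le_sup_left (powSubmodule_le hs) _)
  let r : (S ⧸ basePowSubmodule A 𝔞 t) →ₗ[A] V := Submodule.liftQ _ ρ hρt
  let δ := fun s => LinearEquiv.ofBijective (extConn ω (p + 1) (h s) (hf s) (hg s))
    (haveI := hS s; haveI := hS' s; extConn_bijective (p + 1) (h s) (hf s) (hg s))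
  refine ⟨(δ t).symm.toLinearMap ∘ₗ extMap ω (p + 1 + 1) r, fun s hs => ?_⟩
  have hrc : Function.Surjective (r ∘ₗ c s hs) := fun v => by
    obtain ⟨x, rfl⟩ := hρ v
    exact ⟨Submodule.Quotient.mk x, rfl⟩
  have : Subsingleton (extTo ω (LinearMap.ker (r ∘ₗ c s hs)) (p + 1)) :=
    extTo_subsingleton_of_isFiniteLength (p + 1)
      ((hC s).of_injective (Submodule.injective_subtype _))
  have hinj : Function.Injective (extMap ω (p + 1 + 1) (r ∘ₗ c s hs)) :=
    extMap_injective_of_exact (p + 1) (LinearMap.exact_subtype_ker_map (r ∘ₗ c s hs))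
      (Submodule.injective_subtype _) hrc
  have key : ∀ y, δ s (extMap ω (p + 1) (powTransition J hs) ((δ t).symm
      (extMap ω (p + 1 + 1) r y))) = extMap ω (p + 1 + 1) (r ∘ₗ c s hs) y := fun y => by
    rw [extMap_comp]
    refine (extConn_naturality (p + 1) (h s) (hf s) (hg s) (h t) (hf t) (hg t)
      (powTransition J hs) (u s hs) (c s hs) ?_ ?_ _).trans ?_
    · ext; rfl
    · ext; rfl
    · congr 1
      exact (δ t).apply_symm_apply _
  intro y y' hyy
  apply hinj
  rw [← key, ← key]
  exact congrArg (δ s) hyy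

end stableInjection

section localCohomology

open IsLocalRing

variable {A : Type} [CommRing A] {ω : ModuleCat.{0} A}

lemma exists_injective_pi_extTo (i N : ℕ) {K : Type} [AddCommGroup K] [Module A K] :
    ∃ L : (Fin N → extTo ω K i) →ₗ[A] extTo ω (Fin N → K) i, Function.Injective L := by
  refine ⟨∑ j, extMap ω i (LinearMap.proj j) ∘ₗ LinearMap.proj j, ?_⟩
  rw [injective_iff_map_eq_zero]
  intro w hw
  funext j
  have h1 := congrArg (extMap ω i (LinearMap.single A (fun _ : Fin N => K) j)) hw
  rw [map_zero, LinearMap.sum_apply, map_sum, Finset.sum_eq_single j] at h1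
  · rw [LinearMap.comp_apply, ← extMap_comp, LinearMap.proj_comp_single_same, extMap_id] at h1
    exact h1
  · intro l _ hl
    rw [LinearMap.comp_apply, ← extMap_comp, LinearMap.proj_comp_single_ne _ _ _ _ hl, extMap_zero]
  · simp

lemma exists_map_eq_zero_of_colimit_ι_app_eq_zero {D : Type} [SmallCategory D] [IsFiltered D]
    (F : D ⥤ ModuleCat.{0} A ⥤ ModuleCat.{0} A) (Y : ModuleCat.{0} A) (j : D)
    (z : (F.obj j).obj Y) (hz : (Limits.colimit.ι F j).app Y z = 0) :
    ∃ (k : D) (f : j ⟶ k), (F.map f).app Y z = 0 := by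
  obtain ⟨k, f, g, hfg⟩ := Limits.Concrete.isColimit_exists_of_rep_eq (F ⋙ (evaluation _ _).obj Y)
    (Limits.isColimitOfPreserves ((evaluation _ _).obj Y) (Limits.colimit.isColimit F))
    (i := j) (j := j) z (0 : (F.obj j).obj Y) (hz.trans (map_zero _).symm)
  exact ⟨k, f, hfg.trans (map_zero _)⟩

lemma exists_injective_localCohomology {J : Ideal A} (p t : ℕ) {W : Type} [AddCommGroup W]
    [Module A W] (L : W →ₗ[A] extTo ω (A ⧸ J ^ t) (p + 1))
    (hL : ∀ s (hs : t ≤ s), Function.Injective (extMap ω (p + 1) (powTransition J hs) ∘ₗ L)) :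
    ∃ L' : W →ₗ[A] (localCohomology J (p + 1)).obj ω, Function.Injective L' := by
  obtain ⟨e, he⟩ := exists_ext_equiv ω p
  refine ⟨((Limits.colimit.ι (localCohomology.diagram (localCohomology.idealPowersDiagram J)
    (p + 1)) (op (op t))).app ω).hom ∘ₗ
      (e (ModuleCat.of A (A ⧸ J ^ t))).symm.toLinearMap ∘ₗ L, ?_⟩
  rw [injective_iff_map_eq_zero]
  intro w hw
  obtain ⟨k, f, hf⟩ := exists_map_eq_zero_of_colimit_ι_app_eq_zero
    (localCohomology.diagram (localCohomology.idealPowersDiagram J) (p + 1)) ω (op (op t))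
    ((e (ModuleCat.of A (A ⧸ J ^ t))).symm (L w)) hw
  have hs : t ≤ k.unop.unop := f.unop.unop.down.down
  refine (injective_iff_map_eq_zero _).1 (hL _ hs) w ?_
  have h1 := he (ModuleCat.of A (A ⧸ J ^ k.unop.unop)) (ModuleCat.of A (A ⧸ J ^ t))
    (ModuleCat.ofHom (powTransition J hs)) ((e (ModuleCat.of A (A ⧸ J ^ t))).symm (L w))
  rw [LinearEquiv.apply_symm_apply] at h1
  refine h1.symm.trans ?_
  refine Eq.trans ?_ (map_zero (e (ModuleCat.of A (A ⧸ J ^ k.unop.unop))))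
  exact congrArg _ hf

lemma not_finite_socle_of_injective [IsLocalRing A] {H : Type} [AddCommGroup H] [Module A H]
    (h : ∀ N : ℕ, ∃ L : (Fin N → ResidueField A) →ₗ[A] H, Function.Injective L) :
    ¬ Module.Finite A (ResidueField A →ₗ[A] H) := by
  intro hfin
  have htors : Module.IsTorsionBySet A (ResidueField A →ₗ[A] H) (maximalIdeal A) := by
    intro f r
    ext x
    obtain ⟨x, rfl⟩ := residue_surjective x
    have hr : residue A (r : A) = 0 := (residue_eq_zero_iff _).2 r.2
    rw [LinearMap.smul_apply, ← map_smul, Algebra.smul_def, ResidueField.algebraMap_eq, hr,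
      zero_mul, map_zero, LinearMap.zero_apply]
  let : Module (ResidueField A) (ResidueField A →ₗ[A] H) := htors.module
  have : IsScalarTower A (ResidueField A) (ResidueField A →ₗ[A] H) := htors.isScalarTower
  have : Module.Finite (ResidueField A) (ResidueField A →ₗ[A] H) :=
    Module.Finite.of_restrictScalars_finite A _ _
  obtain ⟨L, hL⟩ := h (Module.finrank (ResidueField A) (ResidueField A →ₗ[A] H) + 1)
  let N := Module.finrank (ResidueField A) (ResidueField A →ₗ[A] H) + 1
  let G : (Fin N → ResidueField A) →ₗ[A] (ResidueField A →ₗ[A] H) :=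
    { toFun := fun v => L ∘ₗ (LinearMap.toSpanSingleton (ResidueField A) _ v).restrictScalars A
      map_add' := fun v w => by ext; simp
      map_smul' := fun r v => by
        ext c
        simp [smul_comm c r v] }
  have hG : Function.Injective G := fun v w hvw => by
    have := LinearMap.congr_fun hvw 1
    simpa [G] using hL (by simpa [G] using this)
  have := LinearMap.finrank_le_finrank_of_injective
    (f := LinearMap.extendScalarsOfSurjective (residue_surjective (R := A)) G) hG
  rw [Module.finrank_fin_fun] at this
  exact absurd this (by simp [N])

theorem localCohomology_socle_not_finite {S : Type} [CommRing S] [Algebra A S] [IsLocalRing A]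
    {J : Ideal A} {𝔞 : Ideal S} (p : ℕ)
    (hJ : ∀ t, (𝔞 ^ t).comap (algebraMap A S) = J ^ t)
    (hk : Subsingleton (extTo ω (ResidueField A) (p + 1)))
    (hk' : Nonempty (extTo ω (ResidueField A) (p + 1 + 1) ≃ₗ[A] ResidueField A))
    (hS : ∀ t, Subsingleton (extTo ω (S ⧸ powSubmodule A 𝔞 t) (p + 1)))
    (hS' : ∀ t, Subsingleton (extTo ω (S ⧸ powSubmodule A 𝔞 t) (p + 1 + 1)))
    (hC : ∀ t, IsFiniteLength A (S ⧸ basePowSubmodule A 𝔞 t))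
    (hρ : ∀ N, ∃ (t : ℕ) (ρ : S →ₗ[A] Fin N → ResidueField A), Function.Surjective ρ ∧
      basePowSubmodule A 𝔞 t ≤ LinearMap.ker ρ) :
    ¬ Module.Finite A (ResidueField A →ₗ[A] (localCohomology J (p + 1)).obj ω) := by
  refine not_finite_socle_of_injective fun N => ?_
  obtain ⟨t, ρ, hρ, hρt⟩ := hρ N
  obtain ⟨e⟩ := hk'
  obtain ⟨L, hL⟩ := exists_linearMap_extTo_stably_injective (ω := ω) p hJ hS hS' hC ρ hρ t hρt
  obtain ⟨L₁, hL₁⟩ := exists_injective_pi_extTo (ω := ω) (p + 1 + 1) N (K := ResidueField A)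
  let E : (Fin N → ResidueField A) ≃ₗ[A] (Fin N → extTo ω (ResidueField A) (p + 1 + 1)) :=
    LinearEquiv.piCongrRight fun _ => e.symm
  exact exists_injective_localCohomology p t (L ∘ₗ L₁ ∘ₗ E.toLinearMap) fun s hs =>
    (hL s hs).comp (hL₁.comp E.injective)

end localCohomology

section finiteLength

open IsLocalRing

variable {A : Type} [CommRing A] [IsLocalRing A] [IsNoetherianRing A]

lemma isFiniteLength_of_pow_maximalIdeal_smul {M : Type} [AddCommGroup M] [Module A M]
    [Module.Finite A M] (s : ℕ) (h : ∀ r ∈ maximalIdeal A ^ s, ∀ z : M, r • z = 0) :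
    IsFiniteLength A M := by
  have hle : maximalIdeal A ^ (s + 1) ≤ maximalIdeal A ^ s := Ideal.pow_le_pow_right (by simp)
  have hne : maximalIdeal A ^ (s + 1) ≠ ⊤ := fun htop =>
    (maximalIdeal.isMaximal A).ne_top (top_unique (htop ▸ Ideal.pow_le_self (by simp)))
  let B := A ⧸ maximalIdeal A ^ (s + 1)
  have : Nontrivial B := Ideal.Quotient.nontrivial_iff.2 hne
  have hsurj : Function.Surjective (algebraMap A B) := Ideal.Quotient.mk_surjective
  have : IsLocalRing B := IsLocalRing.of_surjective' (algebraMap A B) hsurj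
  have : IsNoetherianRing B := isNoetherianRing_of_surjective _ _ (algebraMap A B) hsurj
  have : IsArtinianRing B := by
    rw [isArtinianRing_iff_isNilpotent_maximalIdeal]
    refine ⟨s + 1, ?_⟩
    have : maximalIdeal B ≤ (maximalIdeal A).map (algebraMap A B) := fun b hb => by
      obtain ⟨a, rfl⟩ := hsurj b
      refine Ideal.mem_map_of_mem _ ?_
      rw [mem_maximalIdeal] at hb ⊢
      exact fun ha => hb (ha.map _)
    refine le_bot_iff.1 ((Ideal.pow_right_mono this _).trans ?_)
    rw [← Ideal.map_pow]
    exact (Ideal.map_quotient_self _).le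
  have htors : Module.IsTorsionBySet A M (maximalIdeal A ^ (s + 1) : Ideal A) :=
    fun z r => h r (hle r.2) z
  let : Module B M := htors.module
  have : IsScalarTower A B M := htors.isScalarTower
  have : Module.Finite B M := Module.Finite.of_restrictScalars_finite A _ _
  have h1 : IsFiniteLength B M :=
    isFiniteLength_iff_isNoetherian_isArtinian.2 ⟨inferInstance, inferInstance⟩
  rw [← Module.length_ne_top_iff] at h1 ⊢
  rwa [Module.length_eq_of_surjective (M := M) hsurj]

lemma extTo_subsingleton_of_regular_chain {ω : ModuleCat.{0} A} [Module.Finite A ω] {S : Type}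
    [AddCommGroup S] [Module A S] (U : ℕ → Submodule A S) (x : ℕ → A) (m d : ℕ)
    (hx : ∀ i < m, x i ∈ maximalIdeal A) (hreg : ∀ i < m, ∀ z, x i • z ∈ U i → z ∈ U i)
    (hU : ∀ i < m, ∀ z, z ∈ U (i + 1) ↔ ∃ y, z - x i • y ∈ U i)
    (hfin : Module.Finite A (S ⧸ U 0)) (hlen : IsFiniteLength A (S ⧸ U m))
    (hk : ∀ j > d, Subsingleton (extTo ω (ResidueField A) j)) (j : ℕ) (hj : d < j + m) :
    Subsingleton (extTo ω (S ⧸ U 0) j) := by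
  have hle : ∀ i < m, U i ≤ U (i + 1) := fun i hi z hz => (hU i hi z).2 ⟨0, by simpa⟩
  have hle' : ∀ i ≤ m, U 0 ≤ U i := fun i => by
    induction i with
    | zero => exact fun _ => le_rfl
    | succ i ih => exact fun hi => (ih (by lia)).trans (hle i hi)
  have hfin' : ∀ i ≤ m, Module.Finite A (S ⧸ U i) := fun i hi =>
    Module.Finite.of_surjective (Submodule.mapQ _ _ LinearMap.id (hle' i hi)) fun z => by
      obtain ⟨z, rfl⟩ := Submodule.Quotient.mk_surjective _ z
      exact ⟨Submodule.Quotient.mk z, rfl⟩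
  have key : ∀ l i, i + l = m → ∀ j, d < j + l → Subsingleton (extTo ω (S ⧸ U i) j) := by
    intro l
    induction l with
    | zero =>
      rintro i rfl j hj
      have := hk j (by lia)
      exact extTo_subsingleton_of_isFiniteLength j hlen
    | succ l ih =>
      intro i hi j hj
      have := ih (i + 1) (by lia) (j + 1) (by lia)
      have hi' : i < m := by lia
      have := hfin' i hi'.le
      refine extTo_subsingleton_of_smul_quotient j (hx i hi') ?_
        (Submodule.mapQ (U i) (U (i + 1)) LinearMap.id (hle i hi')) ?_ ?_ ?_
      · intro z hz
        obtain ⟨z, rfl⟩ := Submodule.Quotient.mk_surjective _ z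
        rw [← Submodule.Quotient.mk_smul, Submodule.Quotient.mk_eq_zero] at hz
        exact (Submodule.Quotient.mk_eq_zero _).2 (hreg i hi' z hz)
      · intro z
        obtain ⟨z, rfl⟩ := Submodule.Quotient.mk_surjective _ z
        exact ⟨Submodule.Quotient.mk z, rfl⟩
      · intro z hz
        obtain ⟨z, rfl⟩ := Submodule.Quotient.mk_surjective _ z
        obtain ⟨y, hy⟩ := (hU i hi' z).1 ((Submodule.Quotient.mk_eq_zero _).1 hz)
        exact ⟨Submodule.Quotient.mk y, ((Submodule.Quotient.eq _).2 hy).symm⟩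
      · intro z
        obtain ⟨z, rfl⟩ := Submodule.Quotient.mk_surjective _ z
        exact (Submodule.Quotient.mk_eq_zero _).2 ((hU i hi' _).2 ⟨z, by simp⟩)
  exact key m 0 (zero_add m) j hj

end finiteLength

section coefficientIdeals

variable {σ K : Type} [Field K]

/-- The ideal of power series supported on the exponents of weight at least `t`. -/
def weightIdeal (K : Type) [Field K] (w : (σ →₀ ℕ) →+ ℕ) (t : ℕ) : Ideal (MvPowerSeries σ K) where
  carrier := {f | ∀ γ, w γ < t → coeff γ f = 0}
  zero_mem' := by simp
  add_mem' := fun {f g} hf hg γ h => by rw [map_add, hf γ h, hg γ h, add_zero]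
  smul_mem' := fun c f hf γ h => by
    classical
    rw [smul_eq_mul, coeff_mul]
    refine Finset.sum_eq_zero fun p hp => ?_
    rw [Finset.HasAntidiagonal.mem_antidiagonal] at hp
    rw [hf p.2 (lt_of_le_of_lt (by rw [← hp, map_add]; omega) h), mul_zero]

theorem mem_weightIdeal {w : (σ →₀ ℕ) →+ ℕ} {t : ℕ} {f : MvPowerSeries σ K} :
    f ∈ weightIdeal K w t ↔ ∀ γ, w γ < t → coeff γ f = 0 := Iff.rfl

theorem weightIdeal_mul_le (w : (σ →₀ ℕ) →+ ℕ) (s t : ℕ) :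
    weightIdeal K w s * weightIdeal K w t ≤ weightIdeal K w (s + t) := by
  classical
  refine Ideal.mul_le.2 fun f hf g hg γ h => ?_
  rw [coeff_mul]
  refine Finset.sum_eq_zero fun p hp => ?_
  rw [Finset.HasAntidiagonal.mem_antidiagonal] at hp
  have hw : w p.1 + w p.2 = w γ := by rw [← map_add, hp]
  rcases lt_or_ge (w p.1) s with h1 | h1
  · rw [hf _ h1, zero_mul]
  · rw [hg p.2 (by omega), mul_zero]

theorem weightIdeal_pow_le (w : (σ →₀ ℕ) →+ ℕ) (t : ℕ) :
    weightIdeal K w 1 ^ t ≤ weightIdeal K w t := by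
  induction t with
  | zero => intro f _ γ h; omega
  | succ t ih =>
    rw [pow_succ]
    exact (Ideal.mul_mono_left ih).trans (weightIdeal_mul_le w t 1)

/-- The total degree of an exponent in the variables belonging to `V`. -/
def partDegree (V : Finset σ) : (σ →₀ ℕ) →+ ℕ where
  toFun γ := ∑ v ∈ V, γ v
  map_zero' := by simp
  map_add' := fun a b => by simp [Finset.sum_add_distrib]

theorem partDegree_apply (V : Finset σ) (γ : σ →₀ ℕ) : partDegree V γ = ∑ v ∈ V, γ v := rfl

theorem coeff_X_mul_of_pos {v : σ} {γ : σ →₀ ℕ} (h : γ v ≠ 0) (f : MvPowerSeries σ K) :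
    coeff γ (X v * f) = coeff (γ - Finsupp.single v 1) f := by
  classical
  rw [X_def, coeff_monomial_mul, if_pos (by rw [Finsupp.single_le_iff]; omega), one_mul]

theorem coeff_X_mul_of_zero {v : σ} {γ : σ →₀ ℕ} (h : γ v = 0) (f : MvPowerSeries σ K) :
    coeff γ (X v * f) = 0 := by
  classical
  rw [X_def, coeff_monomial_mul, if_neg (by rw [Finsupp.single_le_iff]; omega)]

theorem weightIdeal_partDegree_succ_le (V : Finset σ) (t : ℕ) :
    weightIdeal K (partDegree V) (t + 1) ≤
      Ideal.span (X '' (V : Set σ)) * weightIdeal K (partDegree V) t := by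
  classical
  intro f hf
  have hex : ∀ γ : σ →₀ ℕ, ∃ o : Option σ,
      partDegree V γ ≠ 0 → ∃ v, o = some v ∧ v ∈ V ∧ γ v ≠ 0 := by
    intro γ
    by_cases h : partDegree V γ = 0
    · exact ⟨none, fun h' => (h' h).elim⟩
    · obtain ⟨v, hv, hv'⟩ := Finset.exists_ne_zero_of_sum_ne_zero h
      exact ⟨some v, fun _ => ⟨v, rfl, hv, hv'⟩⟩
  choose o ho using hex
  let g : σ → MvPowerSeries σ K := fun v η =>
    if o (η + Finsupp.single v 1) = some v then coeff (η + Finsupp.single v 1) f else 0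
  have hterm : ∀ v γ, coeff γ (X v * g v) =
      if o γ = some v ∧ γ v ≠ 0 then coeff γ f else 0 := by
    intro v γ
    by_cases h : γ v = 0
    · rw [coeff_X_mul_of_zero h, if_neg (fun h' => h'.2 h)]
    · have hle : Finsupp.single v 1 ≤ γ := by rw [Finsupp.single_le_iff]; omega
      rw [coeff_X_mul_of_pos h, coeff_apply]
      simp only [g, tsub_add_cancel_of_le hle, h, ne_eq, not_false_eq_true, and_true]
  have hsum : f = ∑ v ∈ V, X v * g v := by
    ext γ
    rw [map_sum]
    simp only [hterm]
    by_cases h : partDegree V γ = 0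
    · rw [hf γ (by omega), Finset.sum_eq_zero]
      intro v _
      split_ifs <;> rfl
    · obtain ⟨v, hv, hvV, hγ⟩ := ho γ h
      rw [Finset.sum_eq_single v, if_pos ⟨hv, hγ⟩]
      · intro u _ hu
        rw [if_neg]
        rintro ⟨h1, _⟩
        exact hu (Option.some_injective _ (h1.symm.trans hv))
      · exact fun h' => (h' hvV).elim
  rw [hsum]
  refine Ideal.sum_mem _ fun v hv => Ideal.mul_mem_mul
    (Ideal.subset_span ⟨v, hv, rfl⟩) fun η hη => ?_
  change (if _ then _ else _) = (0 : K)
  split_ifs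
  · refine hf _ ?_
    have hs : partDegree V (Finsupp.single v 1) = 1 := by
      rw [partDegree_apply, Finset.sum_eq_single v]
      · simp
      · intro u _ hu
        simp [hu.symm]
      · exact fun h' => (h' hv).elim
    rw [map_add, hs]
    omega
  · rfl

theorem span_X_pow_eq_weightIdeal (V : Finset σ) (t : ℕ) :
    Ideal.span (X '' (V : Set σ)) ^ t = weightIdeal K (partDegree V) t := by
  classical
  refine le_antisymm ?_ ?_
  · refine (Ideal.pow_right_mono (Ideal.span_le.2 ?_) t).trans (weightIdeal_pow_le _ t)
    rintro _ ⟨v, hv, rfl⟩ γ hγ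
    have : γ v = 0 := by
      have := Finset.single_le_sum (f := fun v => γ v) (fun _ _ => Nat.zero_le _) hv
      rw [partDegree_apply] at hγ
      omega
    rw [← mul_one (X v), coeff_X_mul_of_zero this]
  · induction t with
    | zero => simp
    | succ t ih =>
      rw [pow_succ']
      exact (weightIdeal_partDegree_succ_le V t).trans (Ideal.mul_mono_right ih)

end coefficientIdeals

section exponents

variable {m n}

/-- The exponent of the image of the variable `x_{ij}` in `S`. -/
def detExp (m n : ℕ) (s : Fin m × Fin n) : Fin m ⊕ Fin (n - 1) →₀ ℕ :=
  Finsupp.single (Sum.inl s.1) 1 +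
    if h : (s.2 : ℕ) < n - 1 then Finsupp.single (Sum.inr ⟨s.2, h⟩) 1 else 0

/-- The exponent of the image in `S` of a monomial of `P`. -/
def detMu (m n : ℕ) : (Fin m × Fin n →₀ ℕ) →+ (Fin m ⊕ Fin (n - 1) →₀ ℕ) :=
  (Finsupp.linearCombination ℕ (detExp m n)).toAddMonoidHom

/-- The total degree in the variables `x_i` of `S`. -/
def degX (m n : ℕ) : (Fin m ⊕ Fin (n - 1) →₀ ℕ) →+ ℕ :=
  partDegree (Finset.univ.map Function.Embedding.inl)

/-- The total degree in the variables `a_j` of `S`. -/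
def degA (m n : ℕ) : (Fin m ⊕ Fin (n - 1) →₀ ℕ) →+ ℕ :=
  partDegree (Finset.univ.map Function.Embedding.inr)

/-- The total degree in the first `n - 1` columns of variables of `P`. -/
def degJ (m n : ℕ) : (Fin m × Fin n →₀ ℕ) →+ ℕ :=
  partDegree (Finset.univ.filter fun s => (s.2 : ℕ) < n - 1)

theorem degX_apply (δ) : degX m n δ = ∑ i, δ (Sum.inl i) := by
  simp [degX, partDegree_apply]

theorem degA_apply (δ) : degA m n δ = ∑ j, δ (Sum.inr j) := by
  simp [degA, partDegree_apply]

theorem detMu_single (s : Fin m × Fin n) (k : ℕ) :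
    detMu m n (Finsupp.single s k) = k • detExp m n s := by
  simp [detMu]

theorem partDegree_single {σ : Type} [DecidableEq σ] (V : Finset σ) (v : σ) (k : ℕ) :
    partDegree V (Finsupp.single v k) = if v ∈ V then k else 0 := by
  rw [partDegree_apply]
  split_ifs with h
  · rw [Finset.sum_eq_single v] <;> simp +contextual [h, eq_comm]
  · refine Finset.sum_eq_zero fun u hu => ?_
    rw [Finsupp.single_apply, if_neg]
    rintro rfl
    exact h hu

theorem degX_detMu (γ) : degX m n (detMu m n γ) = partDegree Finset.univ γ := by
  refine DFunLike.congr_fun (?_ : (degX m n).comp (detMu m n) = partDegree Finset.univ) γ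
  refine Finsupp.addHom_ext fun s k => ?_
  rw [AddMonoidHom.comp_apply, detMu_single, map_nsmul, detExp, map_add, degX]
  split_ifs <;> simp [partDegree_single]

theorem degA_detMu (γ) : degA m n (detMu m n γ) = degJ m n γ := by
  refine DFunLike.congr_fun (?_ : (degA m n).comp (detMu m n) = degJ m n) γ
  refine Finsupp.addHom_ext fun s k => ?_
  rw [AddMonoidHom.comp_apply, detMu_single, map_nsmul, detExp, map_add, degA, degJ]
  split_ifs with h <;> simp [partDegree_single, h]

theorem degX_detMu_eq (γ) : degX m n (detMu m n γ) = degA m n (detMu m n γ) +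
    partDegree (Finset.univ.filter fun s : Fin m × Fin n => ¬ (s.2 : ℕ) < n - 1) γ := by
  rw [degX_detMu, degA_detMu, degJ, partDegree_apply, partDegree_apply, partDegree_apply,
    Finset.sum_filter_add_sum_filter_not]

theorem degA_le_degX (γ) : degA m n (detMu m n γ) ≤ degX m n (detMu m n γ) := by
  rw [degX_detMu_eq]; omega

theorem exists_ne_zero_of_detMu_ne_zero {γ} {t} (h : detMu m n γ t ≠ 0) :
    ∃ s, γ s ≠ 0 ∧ detExp m n s t ≠ 0 := by
  by_contra! hc
  apply h
  change (Finsupp.linearCombination ℕ (detExp m n) γ) t = 0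
  rw [Finsupp.linearCombination_apply, Finsupp.sum, Finsupp.finsetSum_apply]
  refine Finset.sum_eq_zero fun s hs => ?_
  rw [Finsupp.smul_apply, hc s (Finsupp.mem_support_iff.1 hs), smul_zero]

theorem le_of_ne_zero {σ : Type} {γ : σ →₀ ℕ} {s : σ} (h : γ s ≠ 0) :
    ∃ γ', γ = Finsupp.single s 1 + γ' :=
  ⟨γ - Finsupp.single s 1,
    (add_tsub_cancel_of_le (by rw [Finsupp.single_le_iff]; omega)).symm⟩

theorem mem_range_detMu (hn : 2 ≤ n) (δ) (h : degA m n δ ≤ degX m n δ) :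
    ∃ γ, detMu m n γ = δ := by
  induction hd : degX m n δ generalizing δ with
  | zero =>
    refine ⟨0, ?_⟩
    rw [map_zero, eq_comm]
    have h1 := degX_apply δ
    have h2 := degA_apply δ
    rw [hd] at h1 h
    rw [Nat.le_zero.1 h] at h2
    ext (i | j)
    · exact (Finset.sum_eq_zero_iff.1 h1.symm) i (Finset.mem_univ _)
    · exact (Finset.sum_eq_zero_iff.1 h2.symm) j (Finset.mem_univ _)
  | succ d ih =>
    obtain ⟨i, -, hi⟩ := Finset.exists_ne_zero_of_sum_ne_zero
      (show ∑ i, δ (Sum.inl i) ≠ 0 by rw [← degX_apply]; omega)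
    obtain ⟨δ₁, rfl⟩ := le_of_ne_zero hi
    by_cases hA : degA m n δ₁ = 0
    · obtain ⟨γ, hγ⟩ := ih δ₁ (by omega) (by
        rw [map_add, degX, partDegree_single] at hd
        simp at hd
        rw [degX]; omega)
      refine ⟨Finsupp.single (i, ⟨n - 1, by omega⟩) 1 + γ, ?_⟩
      rw [map_add, detMu_single, hγ, detExp]
      simp
    · obtain ⟨j, -, hj⟩ := Finset.exists_ne_zero_of_sum_ne_zero
        (show ∑ j, δ₁ (Sum.inr j) ≠ 0 by rwa [← degA_apply])
      obtain ⟨δ₂, rfl⟩ := le_of_ne_zero hj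
      have hX : degX m n δ₂ = d := by
        rw [map_add, map_add, degX, partDegree_single, partDegree_single] at hd
        simp at hd
        rw [degX]; omega
      obtain ⟨γ, hγ⟩ := ih δ₂ (by
        rw [hX]
        rw [hd, map_add, map_add, degA, partDegree_single, partDegree_single] at h
        simp at h
        rw [degA]; omega) hX
      refine ⟨Finsupp.single (i, ⟨j, by omega⟩) 1 + γ, ?_⟩
      rw [map_add, detMu_single, hγ, detExp]
      simp [add_assoc]

end exponents

section binomials

variable {m n}

theorem exists_row_ne_zero {γ} {i : Fin m} (h : detMu m n γ (Sum.inl i) ≠ 0) :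
    ∃ l, γ (i, l) ≠ 0 := by
  obtain ⟨⟨k, l⟩, hs, ht⟩ := exists_ne_zero_of_detMu_ne_zero h
  refine ⟨l, ?_⟩
  have : k = i := by
    by_contra hne
    apply ht
    rw [detExp]
    split_ifs <;> simp [hne]
  rwa [← this]

theorem exists_column_ne_zero {γ γ'} (h : detMu m n γ = detMu m n γ') {i : Fin m} {j : Fin n}
    (hγ : γ (i, j) ≠ 0) : ∃ k, γ' (k, j) ≠ 0 := by
  by_cases hj : (j : ℕ) < n - 1
  · have h1 : detMu m n γ (Sum.inr ⟨j, hj⟩) ≠ 0 := by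
      obtain ⟨γ₁, rfl⟩ := le_of_ne_zero hγ
      rw [map_add, detMu_single, detExp, dif_pos hj]
      simp
    rw [h] at h1
    obtain ⟨⟨k, l⟩, hs, ht⟩ := exists_ne_zero_of_detMu_ne_zero h1
    refine ⟨k, ?_⟩
    have : l = j := by
      by_contra hne
      apply ht
      rw [detExp]
      split_ifs
      · simpa [Finsupp.single_apply, Fin.ext_iff] using hne
      · simp
    rwa [← this]
  · have h1 := degX_detMu_eq γ
    have h2 := degX_detMu_eq γ'
    rw [h, h2, add_right_inj, partDegree_apply, partDegree_apply] at h1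
    have h3 : ∑ v with ¬ (v.2 : ℕ) < n - 1, γ' v ≠ 0 := by
      rw [h1]
      intro h0
      exact hγ ((Finset.sum_eq_zero_iff.1 h0) (i, j) (by simpa using hj))
    obtain ⟨⟨k, l⟩, hl, hs⟩ := Finset.exists_ne_zero_of_sum_ne_zero h3
    refine ⟨k, ?_⟩
    have : l = j := by
      rw [Finset.mem_filter] at hl
      have := hl.2
      dsimp only at this
      apply Fin.ext
      omega
    rwa [← this]

theorem detExp_add_detExp (i k : Fin m) (j l : Fin n) :
    detExp m n (i, j) + detExp m n (k, l) = detExp m n (i, l) + detExp m n (k, j) := by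
  simp only [detExp]
  abel

theorem minor_mem_detI2 (i k : Fin m) (j l : Fin n) :
    (X (i, j) * X (k, l) - X (i, l) * X (k, j) : DetP 𝕜 m n) ∈ detI2 𝕜 m n := by
  have key : ∀ (i k : Fin m) (j l : Fin n), i < k →
      (X (i, j) * X (k, l) - X (i, l) * X (k, j) : DetP 𝕜 m n) ∈ detI2 𝕜 m n := by
    intro i k j l hik
    rcases lt_trichotomy j l with h | rfl | h
    · exact Ideal.subset_span ⟨i, k, j, l, hik, h, rfl⟩
    · rw [sub_self]; exact zero_mem _
    · rw [← neg_mem_iff, neg_sub]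
      exact Ideal.subset_span ⟨i, k, l, j, hik, h, rfl⟩
  rcases lt_trichotomy i k with h | rfl | h
  · exact key i k j l h
  · rw [mul_comm, sub_self]; exact zero_mem _
  · have := key k i l j h
    rwa [mul_comm (X (k, l)), mul_comm (X (k, j))] at this

theorem monomial_sub_monomial_mem_detI2 (γ γ' : Fin m × Fin n →₀ ℕ)
    (h : detMu m n γ = detMu m n γ') :
    (monomial γ (1 : 𝕜) - monomial γ' 1 : DetP 𝕜 m n) ∈ detI2 𝕜 m n := by
  classical
  induction hd : partDegree Finset.univ γ generalizing γ γ' with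
  | zero =>
    have hd' : partDegree Finset.univ γ' = 0 := by rw [← degX_detMu, ← h, degX_detMu, hd]
    have hz : ∀ γ : Fin m × Fin n →₀ ℕ, partDegree Finset.univ γ = 0 → γ = 0 := by
      intro γ hγ
      ext s
      exact (Finset.sum_eq_zero_iff.1 hγ) s (Finset.mem_univ _)
    rw [hz γ hd, hz γ' hd', sub_self]
    exact zero_mem _
  | succ d ih =>
    have peel : ∀ s γ₁ γ₂, γ = Finsupp.single s 1 + γ₁ →
        detMu m n γ = detMu m n (Finsupp.single s 1 + γ₂) →
        (monomial γ (1 : 𝕜) - monomial (Finsupp.single s 1 + γ₂) 1 : DetP 𝕜 m n) ∈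
          detI2 𝕜 m n := by
      rintro s γ₁ γ₂ rfl h
      rw [map_add, map_add, add_right_inj] at h
      rw [map_add, partDegree_single, if_pos (Finset.mem_univ _)] at hd
      have := Ideal.mul_mem_left _ (X s) (ih γ₁ γ₂ h (by omega))
      rwa [mul_sub, X_def, monomial_mul_monomial, monomial_mul_monomial, one_mul] at this
    obtain ⟨⟨i, j⟩, -, hs⟩ := Finset.exists_ne_zero_of_sum_ne_zero
      (show ∑ v ∈ Finset.univ, γ v ≠ 0 by rw [← partDegree_apply]; omega)
    obtain ⟨γ₁, hγ₁⟩ := le_of_ne_zero hs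
    obtain ⟨k, hk⟩ := exists_column_ne_zero h hs
    obtain ⟨l, hl⟩ := exists_row_ne_zero (γ := γ') (i := i) (by
      rw [← h, hγ₁, map_add, detMu_single, detExp]
      simp)
    obtain ⟨η₁, rfl⟩ := le_of_ne_zero hl
    by_cases hkl : (i, l) = (k, j)
    · have : (i, l) = (i, j) := by
        have := congrArg Prod.snd hkl
        dsimp only at this
        rw [this]
      rw [this] at h ⊢
      exact peel _ γ₁ _ hγ₁ h
    · obtain ⟨η, rfl⟩ := le_of_ne_zero (γ := η₁) (s := (k, j)) (by
        rwa [Finsupp.add_apply, Finsupp.single_apply, if_neg hkl, zero_add] at hk)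
      have hμ : detMu m n γ =
          detMu m n (Finsupp.single (i, j) 1 + (Finsupp.single (k, l) 1 + η)) := by
        rw [h]
        simp only [map_add, detMu_single, one_smul, ← add_assoc]
        rw [detExp_add_detExp]
      have h1 := peel _ γ₁ _ hγ₁ hμ
      have h2 := Ideal.mul_mem_left _ (monomial η (1 : 𝕜)) (minor_mem_detI2 𝕜 i k j l)
      have h3 := add_mem h1 h2
      convert h3 using 1
      simp only [X_def, mul_sub, monomial_mul_monomial, one_mul]
      rw [show η + (Finsupp.single (i, j) 1 + Finsupp.single (k, l) 1) =
        Finsupp.single (i, j) 1 + (Finsupp.single (k, l) 1 + η) by abel,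
        show η + (Finsupp.single (i, l) 1 + Finsupp.single (k, j) 1) =
        Finsupp.single (i, l) 1 + (Finsupp.single (k, j) 1 + η) by abel]
      abel

end binomials

section substitution

theorem detHasSubst :
    HasSubst (fun s => monomial (detExp m n s) (1 : 𝕜) : Fin m × Fin n → DetS 𝕜 m n) := by
  classical
  refine hasSubst_of_constantCoeff_zero fun s => ?_
  rw [← coeff_zero_eq_constantCoeff_apply, coeff_monomial, if_neg]
  intro h
  have := DFunLike.congr_fun h (Sum.inl s.1)
  rw [detExp] at this
  split_ifs at this <;> simp at this

/-- The substitution `x_{ij} ↦ a_j x_i`, `x_{in} ↦ x_i`. -/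
def detSubst : DetP 𝕜 m n →ₐ[𝕜] DetS 𝕜 m n := substAlgHom (detHasSubst 𝕜 m n)

variable {𝕜 m n}

theorem detExp_prod (γ : Fin m × Fin n →₀ ℕ) :
    (γ.prod fun s e => (monomial (detExp m n s) (1 : 𝕜) : DetS 𝕜 m n) ^ e) =
      monomial (detMu m n γ) 1 := by
  rw [Finsupp.prod]
  simp only [monomial_pow, one_pow]
  rw [prod_monomial, Finset.prod_const_one]
  rfl

theorem detSubst_monomial (γ) (c : 𝕜) :
    detSubst 𝕜 m n (monomial γ c) = monomial (detMu m n γ) c := by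
  rw [detSubst, substAlgHom_monomial, detExp_prod, MvPowerSeries.algebraMap_apply,
    ← monomial_zero_eq_C_apply, monomial_mul_monomial]
  simp

theorem detSubst_X (s) : detSubst 𝕜 m n (X s) = monomial (detExp m n s) 1 := by
  rw [X_def, detSubst_monomial, detMu_single, one_smul]

theorem coeff_detSubst (F : DetP 𝕜 m n) (δ) :
    coeff δ (detSubst 𝕜 m n F) =
      ∑ᶠ γ, coeff γ F • coeff δ (monomial (detMu m n γ) (1 : 𝕜)) := by
  rw [detSubst, substAlgHom_apply, coeff_subst (detHasSubst 𝕜 m n)]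
  simp only [detExp_prod]

theorem coeff_detSubst_eq_zero {F : DetP 𝕜 m n} {δ}
    (h : ∀ γ, detMu m n γ = δ → coeff γ F = 0) : coeff δ (detSubst 𝕜 m n F) = 0 := by
  classical
  rw [coeff_detSubst, ← finsum_zero (α := Fin m × Fin n →₀ ℕ)]
  congr 1
  ext γ
  rw [coeff_monomial]
  split_ifs with h'
  · rw [h γ h'.symm, zero_smul]
  · rw [smul_zero]

theorem coeff_detSubst_of_not_mem_range (F : DetP 𝕜 m n) {δ}
    (h : degX m n δ < degA m n δ) : coeff δ (detSubst 𝕜 m n F) = 0 := by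
  refine coeff_detSubst_eq_zero fun γ hγ => ?_
  have := degA_le_degX γ
  rw [hγ] at this
  omega

/-- A section of `detMu` on its range. -/
def detSec (m n : ℕ) (δ : Fin m ⊕ Fin (n - 1) →₀ ℕ) : Fin m × Fin n →₀ ℕ :=
  Function.invFun (detMu m n) δ

theorem detMu_detSec (γ) : detMu m n (detSec m n (detMu m n γ)) = detMu m n γ :=
  Function.invFun_eq ⟨γ, rfl⟩

variable (𝕜 m n) in
/-- A linear section of `detSubst` on the series supported on the range of `detMu`. -/
def detLift : DetS 𝕜 m n →ₗ[𝕜] DetP 𝕜 m n where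
  toFun g γ := (open Classical in if γ = detSec m n (detMu m n γ) then 1 else 0) *
    coeff (detMu m n γ) g
  map_add' _ _ := funext fun _ => mul_add _ _ _
  map_smul' _ _ := funext fun _ => mul_left_comm _ _ _

open Classical in
theorem coeff_detLift (g : DetS 𝕜 m n) (γ) : coeff γ (detLift 𝕜 m n g) =
    if γ = detSec m n (detMu m n γ) then coeff (detMu m n γ) g else 0 :=
  boole_mul _ _

theorem detSubst_detLift {g : DetS 𝕜 m n}
    (hg : ∀ δ, coeff δ g ≠ 0 → ∃ γ, detMu m n γ = δ) : detSubst 𝕜 m n (detLift 𝕜 m n g) = g := by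
  classical
  ext δ
  by_cases h : ∃ γ, detMu m n γ = δ
  · obtain ⟨γ, rfl⟩ := h
    rw [coeff_detSubst, finsum_eq_single _ (detSec m n (detMu m n γ))]
    · rw [detMu_detSec, coeff_monomial_same, coeff_detLift, detMu_detSec, if_pos rfl, smul_eq_mul,
        mul_one]
    · intro γ' hγ'
      rw [coeff_detLift, coeff_monomial]
      split_ifs with h1 h2
      · rw [← h2] at h1
        exact (hγ' h1).elim
      all_goals simp
  · rw [coeff_detSubst_eq_zero fun γ hγ => (h ⟨γ, hγ⟩).elim, eq_comm]
    by_contra hne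
    exact h (hg δ hne)

theorem detLift_detSubst_monomial (γ) (c : 𝕜) :
    detLift 𝕜 m n (detSubst 𝕜 m n (monomial γ c)) = monomial (detSec m n (detMu m n γ)) c := by
  classical
  rw [detSubst_monomial]
  ext γ'
  rw [coeff_detLift, coeff_monomial, coeff_monomial]
  by_cases h : γ' = detSec m n (detMu m n γ)
  · subst h
    rw [detMu_detSec, if_pos rfl, if_pos rfl, if_pos rfl]
  · rw [if_neg h]
    split_ifs with h1 h2
    · rw [h2] at h1
      exact (h h1).elim
    all_goals rfl

theorem detSubst_mem_weightIdeal {F : DetP 𝕜 m n} {w} {w'} {t : ℕ}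
    (hw : ∀ γ, w (detMu m n γ) = w' γ) (hF : F ∈ weightIdeal 𝕜 w' t) :
    detSubst 𝕜 m n F ∈ weightIdeal 𝕜 w t := by
  intro δ hδ
  refine coeff_detSubst_eq_zero fun γ hγ => hF γ ?_
  rwa [← hw, hγ]

theorem detLift_mem_weightIdeal {g : DetS 𝕜 m n} {w} {w'} {t : ℕ}
    (hw : ∀ γ, w (detMu m n γ) = w' γ) (hg : g ∈ weightIdeal 𝕜 w t) :
    detLift 𝕜 m n g ∈ weightIdeal 𝕜 w' t := by
  classical
  intro γ hγ
  rw [coeff_detLift]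
  split_ifs
  · exact hg _ (by rwa [hw])
  · rfl

theorem detSubst_eq_zero_of_mem {F : DetP 𝕜 m n} (hF : F ∈ detI2 𝕜 m n) :
    detSubst 𝕜 m n F = 0 := by
  refine (Ideal.span_le.2 ?_ : detI2 𝕜 m n ≤ RingHom.ker (detSubst 𝕜 m n)) hF
  rintro _ ⟨i, k, j, l, -, -, rfl⟩
  rw [SetLike.mem_coe, RingHom.mem_ker, map_sub, map_mul, map_mul]
  simp only [detSubst_X, monomial_mul_monomial]
  rw [detExp_add_detExp, sub_self]

theorem detI2_le_constantCoeff {F : DetP 𝕜 m n} (hF : F ∈ detI2 𝕜 m n) :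
    constantCoeff F = 0 := by
  refine (Ideal.span_le.2 ?_ : detI2 𝕜 m n ≤ RingHom.ker (constantCoeff (R := 𝕜))) hF
  rintro _ ⟨i, k, j, l, -, -, rfl⟩
  simp [RingHom.mem_ker]

theorem weightIdeal_partDegree_univ_one_le_ker :
    weightIdeal 𝕜 (partDegree (Finset.univ : Finset (Fin m × Fin n))) 1 ≤
      RingHom.ker (constantCoeff (R := 𝕜)) := by
  intro F hF
  rw [RingHom.mem_ker, ← coeff_zero_eq_constantCoeff_apply]
  exact hF 0 (by simp)

theorem mem_detI2_of_forall_mem_sup {F : DetP 𝕜 m n}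
    (h : ∀ N, F ∈ detI2 𝕜 m n ⊔ weightIdeal 𝕜 (partDegree Finset.univ) N)
    [IsLocalRing (DetR 𝕜 m n)] : F ∈ detI2 𝕜 m n := by
  set M : Ideal (DetP 𝕜 m n) := weightIdeal 𝕜 (partDegree Finset.univ) 1 with hM
  have hpow : ∀ N, weightIdeal 𝕜 (partDegree Finset.univ) N = M ^ N := by
    intro N
    have h1 := span_X_pow_eq_weightIdeal (K := 𝕜) (Finset.univ : Finset (Fin m × Fin n)) 1
    rw [pow_one] at h1
    rw [hM, ← h1, span_X_pow_eq_weightIdeal]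
  have hne : M.map (Ideal.Quotient.mk (detI2 𝕜 m n)) ≠ ⊤ := by
    intro htop
    have h1 := (Ideal.eq_top_iff_one _).1 htop
    rw [← map_one (Ideal.Quotient.mk (detI2 𝕜 m n)),
      ← Ideal.mem_comap, Ideal.comap_map_of_surjective' _ Ideal.Quotient.mk_surjective,
      Ideal.mk_ker] at h1
    have h2 : M ⊔ detI2 𝕜 m n ≤ RingHom.ker (constantCoeff (R := 𝕜)) :=
      sup_le weightIdeal_partDegree_univ_one_le_ker fun F hF => detI2_le_constantCoeff hF
    have := h2 h1
    simp [RingHom.mem_ker] at this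
  rw [← Ideal.Quotient.eq_zero_iff_mem, ← Ideal.mem_bot,
    ← Ideal.iInf_pow_eq_bot_of_isLocalRing _ hne, Ideal.mem_iInf]
  intro N
  rw [← Ideal.map_pow, ← hpow]
  have := Ideal.mem_map_of_mem (Ideal.Quotient.mk (detI2 𝕜 m n)) (h N)
  rwa [Ideal.map_sup, Ideal.map_quotient_self, bot_sup_eq] at this

theorem sub_detLift_detSubst_mem [IsLocalRing (DetR 𝕜 m n)] (F : DetP 𝕜 m n) :
    F - detLift 𝕜 m n (detSubst 𝕜 m n F) ∈ detI2 𝕜 m n := by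
  classical
  refine mem_detI2_of_forall_mem_sup fun N => ?_
  have hfin : {γ : Fin m × Fin n →₀ ℕ | partDegree Finset.univ γ < N}.Finite := by
    refine (Set.finite_Iic (Finsupp.equivFunOnFinite.symm fun _ => N)).subset fun γ hγ s => ?_
    have := Finset.single_le_sum (f := fun v => γ v) (fun _ _ => Nat.zero_le _)
      (Finset.mem_univ s)
    rw [Set.mem_ofPred_eq, partDegree_apply] at hγ
    simp only [Finsupp.equivFunOnFinite_symm_apply_apply]
    omega
  let G : DetP 𝕜 m n := ∑ γ ∈ hfin.toFinset, monomial γ (coeff γ F)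
  have hG : F - G ∈ weightIdeal 𝕜 (partDegree Finset.univ) N := by
    intro γ hγ
    rw [map_sub, map_sum, Finset.sum_eq_single γ, coeff_monomial_same, sub_self]
    · intro γ' _ hne
      rw [coeff_monomial_ne hne.symm]
    · intro h
      exact (h (hfin.mem_toFinset.2 hγ)).elim
  have hG' : G - detLift 𝕜 m n (detSubst 𝕜 m n G) ∈ detI2 𝕜 m n := by
    rw [map_sum, map_sum, ← Finset.sum_sub_distrib]
    refine Ideal.sum_mem _ fun γ _ => ?_
    rw [detLift_detSubst_monomial]
    have := Ideal.mul_mem_left _ (C (coeff γ F))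
      (monomial_sub_monomial_mem_detI2 𝕜 γ (detSec m n (detMu m n γ)) (detMu_detSec γ).symm)
    rwa [mul_sub, ← monomial_zero_eq_C_apply, monomial_mul_monomial, monomial_mul_monomial,
      zero_add, zero_add, mul_one] at this
  have hL := detLift_mem_weightIdeal degX_detMu (detSubst_mem_weightIdeal degX_detMu hG)
  rw [map_sub, map_sub] at hL
  have := Submodule.add_mem_sup hG' (sub_mem hG hL)
  convert this using 1
  abel

end substitution

section algebraStructure

variable {𝕜 m n}

/-- The `R`-algebra structure on `S` given by `x_{ij} ↦ a_j x_i`, `x_{in} ↦ x_i`. -/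
instance detAlgebra : Algebra (DetR 𝕜 m n) (DetS 𝕜 m n) :=
  (Ideal.Quotient.lift (detI2 𝕜 m n) (detSubst 𝕜 m n : DetP 𝕜 m n →+* DetS 𝕜 m n)
    fun _ h => detSubst_eq_zero_of_mem h).toAlgebra

theorem algebraMap_mk (F : DetP 𝕜 m n) :
    algebraMap (DetR 𝕜 m n) (DetS 𝕜 m n) (Ideal.Quotient.mk _ F) = detSubst 𝕜 m n F := rfl

theorem mk_smul (F : DetP 𝕜 m n) (f : DetS 𝕜 m n) :
    (Ideal.Quotient.mk _ F : DetR 𝕜 m n) • f = detSubst 𝕜 m n F * f := by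
  rw [Algebra.smul_def, algebraMap_mk]

theorem detA_pow (t : ℕ) : detA 𝕜 m n ^ t = weightIdeal 𝕜 (degA m n) t := by
  rw [degA, ← span_X_pow_eq_weightIdeal, detA]
  congr 2
  ext f
  simp [eq_comm]

theorem detJ_pow (t : ℕ) :
    detJ 𝕜 m n ^ t = (weightIdeal 𝕜 (degJ m n) t).map (Ideal.Quotient.mk (detI2 𝕜 m n)) := by
  rw [degJ, ← span_X_pow_eq_weightIdeal, Ideal.map_pow, Ideal.map_span, detJ, ← Set.image_comp]
  congr 2
  ext f
  simp [detx, eq_comm]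

theorem comap_detA_pow [IsLocalRing (DetR 𝕜 m n)] (t : ℕ) :
    (detA 𝕜 m n ^ t).comap (algebraMap (DetR 𝕜 m n) (DetS 𝕜 m n)) = detJ 𝕜 m n ^ t := by
  rw [detA_pow, detJ_pow]
  refine le_antisymm ?_ ?_
  · intro r hr
    obtain ⟨F, rfl⟩ := Ideal.Quotient.mk_surjective r
    rw [Ideal.mem_comap, algebraMap_mk] at hr
    have h1 := Ideal.mem_map_of_mem (Ideal.Quotient.mk (detI2 𝕜 m n))
      (detLift_mem_weightIdeal degA_detMu hr)
    rwa [← Ideal.Quotient.eq.2 (sub_detLift_detSubst_mem F)] at h1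
  · rw [Ideal.map_le_iff_le_comap]
    intro F hF
    rw [Ideal.mem_comap, Ideal.mem_comap, algebraMap_mk]
    exact detSubst_mem_weightIdeal degA_detMu hF

theorem exists_sub_algebraMap_mem (hn : 2 ≤ n) (t : ℕ) (f : DetS 𝕜 m n)
    (hf : ∀ γ, coeff γ f ≠ 0 → degA m n γ < t → degA m n γ ≤ degX m n γ) :
    ∃ r : DetR 𝕜 m n, f - algebraMap _ _ r ∈ detA 𝕜 m n ^ t := by
  classical
  let g : DetS 𝕜 m n := fun γ => if degA m n γ < t then coeff γ f else 0
  have hg : ∀ γ, coeff γ g = if degA m n γ < t then coeff γ f else 0 := fun _ => rfl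
  refine ⟨Ideal.Quotient.mk _ (detLift 𝕜 m n g), ?_⟩
  rw [algebraMap_mk, detSubst_detLift, detA_pow]
  · intro γ hγ
    rw [map_sub, hg, if_pos hγ, sub_self]
  · intro δ hδ
    rw [hg] at hδ
    split_ifs at hδ with h
    · exact mem_range_detMu hn δ (hf δ hδ h)
    · exact (hδ rfl).elim

theorem exists_fg_sup_powSubmodule_eq_top (hn : 2 ≤ n) (t : ℕ) :
    ∃ N : Submodule (DetR 𝕜 m n) (DetS 𝕜 m n),
      N.FG ∧ N ⊔ powSubmodule (DetR 𝕜 m n) (detA 𝕜 m n) t = ⊤ := by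
  induction t with
  | zero =>
    refine ⟨⊥, Submodule.fg_bot, ?_⟩
    rw [bot_sup_eq, eq_top_iff]
    intro f _
    simp [powSubmodule]
  | succ t ih =>
    obtain ⟨N, hN, htop⟩ := ih
    obtain ⟨G, hG⟩ := (isNoetherianRing_iff_ideal_fg _).1 inferInstance (detA 𝕜 m n ^ t)
    replace hG : Submodule.span (DetS 𝕜 m n) (G : Set (DetS 𝕜 m n)) = detA 𝕜 m n ^ t := hG
    refine ⟨N ⊔ Submodule.span _ (G : Set (DetS 𝕜 m n)), hN.sup (Submodule.fg_span G.finite_toSet),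
      ?_⟩
    rw [eq_top_iff, ← htop, sup_assoc]
    refine sup_le_sup_left ?_ N
    intro f hf
    have hf' : f ∈ Submodule.span (DetS 𝕜 m n) (G : Set (DetS 𝕜 m n)) := by
      rw [hG]; exact hf
    induction hf' using Submodule.span_induction with
    | mem x hx => exact Submodule.mem_sup_left (Submodule.subset_span hx)
    | zero => exact zero_mem _
    | add x y hx hy h1 h2 =>
      rw [hG] at hx hy
      exact add_mem (h1 hx) (h2 hy)
    | smul s x hx h =>
      rw [hG] at hx
      obtain ⟨r, hr⟩ := exists_sub_algebraMap_mem (𝕜 := 𝕜) (m := m) hn 1 s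
        (fun γ _ h => by omega)
      have hsx : s • x = r • x + (s - algebraMap _ _ r) * x := by
        rw [smul_eq_mul, Algebra.smul_def]; ring
      rw [hsx]
      refine add_mem (Submodule.smul_mem _ _ (h hx)) (Submodule.mem_sup_right ?_)
      change _ ∈ detA 𝕜 m n ^ (t + 1)
      rw [add_comm, pow_add]
      exact Ideal.mul_mem_mul hr hx

theorem finite_quotient_of_powSubmodule_le (hn : 2 ≤ n) (t : ℕ)
    {U : Submodule (DetR 𝕜 m n) (DetS 𝕜 m n)}
    (hU : powSubmodule (DetR 𝕜 m n) (detA 𝕜 m n) t ≤ U) :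
    Module.Finite (DetR 𝕜 m n) (DetS 𝕜 m n ⧸ U) := by
  obtain ⟨N, hN, htop⟩ := exists_fg_sup_powSubmodule_eq_top (𝕜 := 𝕜) (m := m) hn t
  refine ⟨?_⟩
  have : N.map U.mkQ = ⊤ := by
    have h1 : N ⊔ U = ⊤ := by
      rw [eq_top_iff, ← htop]
      exact sup_le_sup_left hU N
    have h2 := congrArg (Submodule.map U.mkQ) h1
    rwa [Submodule.map_sup, Submodule.mkQ_map_self, sup_bot_eq, Submodule.map_top,
      Submodule.range_mkQ] at h2
  rw [← this]
  exact hN.map _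

theorem constantCoeff_eq_zero_of_mem_maximalIdeal [IsLocalRing (DetR 𝕜 m n)] {F : DetP 𝕜 m n}
    (h : Ideal.Quotient.mk _ F ∈ IsLocalRing.maximalIdeal (DetR 𝕜 m n)) :
    constantCoeff F = 0 := by
  by_contra hne
  exact h ((MvPowerSeries.isUnit_iff_constantCoeff.2 (isUnit_iff_ne_zero.2 hne)).map _)

theorem mk_mem_maximalIdeal [IsLocalRing (DetR 𝕜 m n)] {F : DetP 𝕜 m n}
    (h : constantCoeff F = 0) :
    Ideal.Quotient.mk _ F ∈ IsLocalRing.maximalIdeal (DetR 𝕜 m n) := by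
  intro hu
  obtain ⟨r, hr⟩ := hu.exists_right_inv
  obtain ⟨G, rfl⟩ := Ideal.Quotient.mk_surjective r
  rw [← map_mul, ← map_one (Ideal.Quotient.mk (detI2 𝕜 m n)), Ideal.Quotient.eq] at hr
  have := detI2_le_constantCoeff hr
  rw [map_sub, map_mul, h, zero_mul, map_one, zero_sub, neg_eq_zero] at this
  exact one_ne_zero this

theorem mem_weightIdeal_one_of_constantCoeff {F : DetP 𝕜 m n} (h : constantCoeff F = 0) :
    F ∈ weightIdeal 𝕜 (partDegree Finset.univ) 1 := by
  intro γ hγ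
  have : γ = 0 := by
    ext s
    exact (Finset.sum_eq_zero_iff.1 (Nat.lt_one_iff.1 hγ)) s (Finset.mem_univ _)
  rw [this, coeff_zero_eq_constantCoeff_apply, h]

theorem algebraMap_mem_weightIdeal [IsLocalRing (DetR 𝕜 m n)] {t : ℕ} {r : DetR 𝕜 m n}
    (hr : r ∈ IsLocalRing.maximalIdeal (DetR 𝕜 m n) ^ t) :
    algebraMap _ (DetS 𝕜 m n) r ∈ weightIdeal 𝕜 (degX m n) t := by
  have h1 : IsLocalRing.maximalIdeal (DetR 𝕜 m n) ≤
      (weightIdeal 𝕜 (degX m n) 1).comap (algebraMap (DetR 𝕜 m n) (DetS 𝕜 m n)) := by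
    intro r hr
    obtain ⟨F, rfl⟩ := Ideal.Quotient.mk_surjective r
    rw [Ideal.mem_comap, algebraMap_mk]
    exact detSubst_mem_weightIdeal degX_detMu
      (mem_weightIdeal_one_of_constantCoeff (constantCoeff_eq_zero_of_mem_maximalIdeal hr))
  exact weightIdeal_pow_le _ t (Ideal.le_comap_pow _ t (Ideal.pow_right_mono h1 t hr))

theorem isFiniteLength_quotient_basePowSubmodule [IsLocalRing (DetR 𝕜 m n)] (hn : 2 ≤ n)
    (t : ℕ) : IsFiniteLength (DetR 𝕜 m n)
      (DetS 𝕜 m n ⧸ basePowSubmodule (DetR 𝕜 m n) (detA 𝕜 m n) t) := by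
  have := finite_quotient_of_powSubmodule_le (𝕜 := 𝕜) (m := m) hn t
    (U := basePowSubmodule (DetR 𝕜 m n) (detA 𝕜 m n) t) le_sup_right
  refine isFiniteLength_of_pow_maximalIdeal_smul t fun r hr z => ?_
  obtain ⟨f, rfl⟩ := Submodule.mkQ_surjective _ z
  rw [← map_smul, Submodule.mkQ_apply, Submodule.Quotient.mk_eq_zero]
  have h1 : r • f ∈ weightIdeal 𝕜 (degX m n) t := by
    rw [Algebra.smul_def]
    exact Ideal.mul_mem_right _ _ (algebraMap_mem_weightIdeal hr)
  obtain ⟨r', hr'⟩ := exists_sub_algebraMap_mem hn t (r • f) (fun γ hγ hA => by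
    by_contra hlt
    exact hγ (h1 γ (by omega)))
  rw [← add_sub_cancel (algebraMap _ (DetS 𝕜 m n) r') (r • f)]
  exact Submodule.add_mem_sup ⟨r', rfl⟩ hr'

end algebraStructure

section regularChain

variable {𝕜 m n}

/-- Series whose monomials have degree at least `t` in the `a_j` or involve one of the first `i`
variables `x_l`. -/
def chainIdeal (𝕜 : Type) [Field 𝕜] (m n t i : ℕ) : Ideal (DetS 𝕜 m n) where
  carrier := {f | ∀ γ, degA m n γ < t → (∀ l : Fin m, (l : ℕ) < i → γ (Sum.inl l) = 0) →
    coeff γ f = 0}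
  zero_mem' := by simp
  add_mem' := fun {f g} hf hg γ h h' => by rw [map_add, hf γ h h', hg γ h h', add_zero]
  smul_mem' := fun c f hf γ h h' => by
    classical
    rw [smul_eq_mul, coeff_mul]
    refine Finset.sum_eq_zero fun p hp => ?_
    rw [Finset.HasAntidiagonal.mem_antidiagonal] at hp
    rw [hf p.2 (lt_of_le_of_lt (by rw [← hp, map_add]; omega) h) fun l hl => ?_, mul_zero]
    have := h' l hl
    rw [← hp, Finsupp.add_apply] at this
    omega

/-- The ideal `chainIdeal`, as an `R`-submodule of `S`. -/
abbrev chainSubmodule (𝕜 : Type) [Field 𝕜] (m n t i : ℕ) :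
    Submodule (DetR 𝕜 m n) (DetS 𝕜 m n) :=
  (chainIdeal 𝕜 m n t i).restrictScalars _

theorem mem_chainSubmodule {t i : ℕ} {f : DetS 𝕜 m n} :
    f ∈ chainSubmodule 𝕜 m n t i ↔
      ∀ γ, degA m n γ < t → (∀ l : Fin m, (l : ℕ) < i → γ (Sum.inl l) = 0) → coeff γ f = 0 :=
  Iff.rfl

theorem chainSubmodule_zero (t : ℕ) :
    chainSubmodule 𝕜 m n t 0 = powSubmodule (DetR 𝕜 m n) (detA 𝕜 m n) t := by
  ext f
  rw [mem_chainSubmodule, Submodule.restrictScalars_mem, detA_pow, mem_weightIdeal]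
  simp

theorem powSubmodule_le_chainSubmodule (t i : ℕ) :
    powSubmodule (DetR 𝕜 m n) (detA 𝕜 m n) t ≤ chainSubmodule 𝕜 m n t i := by
  intro f hf
  rw [Submodule.restrictScalars_mem, detA_pow] at hf
  exact fun γ h _ => hf γ h

theorem detx_last_smul (hn : 2 ≤ n) (i : Fin m) (f : DetS 𝕜 m n) :
    detx 𝕜 m n i ⟨n - 1, by omega⟩ • f = X (Sum.inl i) * f := by
  rw [detx, mk_smul, detSubst_X, detExp, dif_neg (lt_irrefl _), add_zero, X_def]

theorem degA_add_single_inl (γ) (i : Fin m) :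
    degA m n (γ + Finsupp.single (Sum.inl i) 1) = degA m n γ := by
  rw [map_add, degA, partDegree_single]
  simp

theorem mem_chainSubmodule_of_X_mul_mem {t : ℕ} (i : Fin m) (z : DetS 𝕜 m n)
    (h : X (Sum.inl i) * z ∈ chainSubmodule 𝕜 m n t i) : z ∈ chainSubmodule 𝕜 m n t i := by
  intro γ hγ h0
  have h1 := h (γ + Finsupp.single (Sum.inl i) 1) (by rwa [degA_add_single_inl]) (fun l hl => by
    rw [Finsupp.add_apply, h0 l hl, zero_add, Finsupp.single_apply, if_neg]
    intro he
    rw [Sum.inl_injective he] at hl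
    exact lt_irrefl _ hl)
  rwa [coeff_X_mul_of_pos (by simp), add_tsub_cancel_right] at h1

theorem mem_chainSubmodule_succ_iff {t : ℕ} (i : Fin m) (z : DetS 𝕜 m n) :
    z ∈ chainSubmodule 𝕜 m n t (i + 1) ↔
      ∃ y, z - X (Sum.inl i) * y ∈ chainSubmodule 𝕜 m n t i := by
  have hsucc : ∀ γ : Fin m ⊕ Fin (n - 1) →₀ ℕ,
      (∀ l : Fin m, (l : ℕ) < i + 1 → γ (Sum.inl l) = 0) ↔
        (∀ l : Fin m, (l : ℕ) < i → γ (Sum.inl l) = 0) ∧ γ (Sum.inl i) = 0 := by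
    refine fun γ => ⟨fun h => ⟨fun l hl => h l (by omega), h i (by omega)⟩, fun h l hl => ?_⟩
    rcases Nat.lt_succ_iff_lt_or_eq.1 hl with h' | h'
    · exact h.1 l h'
    · rw [Fin.ext h', h.2]
  constructor
  · intro hz
    let y : DetS 𝕜 m n := fun γ => coeff (γ + Finsupp.single (Sum.inl i) 1) z
    refine ⟨y, fun γ hγ h0 => ?_⟩
    by_cases hi : γ (Sum.inl i) = 0
    · rw [map_sub, coeff_X_mul_of_zero hi, sub_zero]
      exact hz γ hγ ((hsucc γ).2 ⟨h0, hi⟩)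
    · rw [map_sub, coeff_X_mul_of_pos hi, coeff_apply y]
      simp only [y]
      rw [tsub_add_cancel_of_le (by rw [Finsupp.single_le_iff]; omega), sub_self]
  · rintro ⟨y, hy⟩ γ hγ h0
    obtain ⟨h1, h2⟩ := (hsucc γ).1 h0
    have := hy γ hγ h1
    rwa [map_sub, coeff_X_mul_of_zero h2, sub_zero] at this

theorem isFiniteLength_quotient_chainSubmodule [IsLocalRing (DetR 𝕜 m n)] (hn : 2 ≤ n)
    (t : ℕ) : IsFiniteLength (DetR 𝕜 m n) (DetS 𝕜 m n ⧸ chainSubmodule 𝕜 m n t m) := by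
  have := finite_quotient_of_powSubmodule_le (𝕜 := 𝕜) (m := m) hn t
    (powSubmodule_le_chainSubmodule t m)
  refine isFiniteLength_of_pow_maximalIdeal_smul 1 fun r hr z => ?_
  obtain ⟨f, rfl⟩ := Submodule.mkQ_surjective _ z
  rw [← map_smul, Submodule.mkQ_apply, Submodule.Quotient.mk_eq_zero]
  have h1 : r • f ∈ weightIdeal 𝕜 (degX m n) 1 := by
    rw [Algebra.smul_def]
    exact Ideal.mul_mem_right _ _ (algebraMap_mem_weightIdeal hr)
  refine fun γ _ h0 => h1 γ ?_
  rw [degX_apply, Finset.sum_eq_zero fun l _ => h0 l l.2]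
  exact zero_lt_one

theorem extTo_quotient_powSubmodule_subsingleton [IsLocalRing (DetR 𝕜 m n)] (hn : 2 ≤ n)
    {ω : ModuleCat (DetR 𝕜 m n)} [Module.Finite (DetR 𝕜 m n) ω] (d : ℕ)
    (hk : ∀ j > d, Subsingleton (extTo ω (IsLocalRing.ResidueField (DetR 𝕜 m n)) j))
    (t j : ℕ) (hj : d < j + m) :
    Subsingleton (extTo ω (DetS 𝕜 m n ⧸ powSubmodule (DetR 𝕜 m n) (detA 𝕜 m n) t) j) := by
  have hx : ∀ i (hi : i < m), (if h : i < m then detx 𝕜 m n ⟨i, h⟩ ⟨n - 1, by omega⟩ else 0) =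
      detx 𝕜 m n ⟨i, hi⟩ ⟨n - 1, by omega⟩ := fun i hi => dif_pos hi
  have := extTo_subsingleton_of_regular_chain (ω := ω) (chainSubmodule 𝕜 m n t)
    (fun i => if h : i < m then detx 𝕜 m n ⟨i, h⟩ ⟨n - 1, by omega⟩ else 0) m d
    (fun i hi => by
      rw [hx i hi]
      exact mk_mem_maximalIdeal (constantCoeff_X _))
    (fun i hi z hz => by
      rw [hx i hi, detx_last_smul hn] at hz
      exact mem_chainSubmodule_of_X_mul_mem ⟨i, hi⟩ z hz)
    (fun i hi z => by
      simp only [hx i hi, detx_last_smul hn]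
      exact mem_chainSubmodule_succ_iff ⟨i, hi⟩ z)
    (finite_quotient_of_powSubmodule_le hn t (powSubmodule_le_chainSubmodule t 0))
    (isFiniteLength_quotient_chainSubmodule hn t) hk j hj
  rwa [chainSubmodule_zero] at this

end regularChain

section residues

variable {𝕜 m n}

theorem constantCoeff_detSubst (F : DetP 𝕜 m n) :
    coeff 0 (detSubst 𝕜 m n F) = constantCoeff F := by
  have h1 : F - C (constantCoeff F) ∈ weightIdeal 𝕜 (partDegree Finset.univ) 1 :=
    mem_weightIdeal_one_of_constantCoeff (by simp)
  have h2 := detSubst_mem_weightIdeal degX_detMu h1 0 (by simp)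
  rwa [map_sub, map_sub, ← monomial_zero_eq_C_apply, detSubst_monomial, map_zero,
    coeff_monomial_same, sub_eq_zero] at h2

theorem residue_mk [IsLocalRing (DetR 𝕜 m n)] (F : DetP 𝕜 m n) :
    IsLocalRing.residue (DetR 𝕜 m n) (Ideal.Quotient.mk _ F) =
      IsLocalRing.residue (DetR 𝕜 m n) (Ideal.Quotient.mk _ (C (constantCoeff F))) := by
  rw [← sub_eq_zero, ← map_sub, ← map_sub, IsLocalRing.residue_eq_zero_iff]
  exact mk_mem_maximalIdeal (by simp)

theorem coeff_single_inr_smul (j : Fin (n - 1)) (e : ℕ) (F : DetP 𝕜 m n) (f : DetS 𝕜 m n) :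
    coeff (Finsupp.single (Sum.inr j) e) ((Ideal.Quotient.mk _ F : DetR 𝕜 m n) • f) =
      constantCoeff F * coeff (Finsupp.single (Sum.inr j) e) f := by
  classical
  rw [mk_smul, coeff_mul, Finset.sum_eq_single (0, Finsupp.single (Sum.inr j) e)]
  · rw [constantCoeff_detSubst]
  · rintro ⟨p, q⟩ hp hne
    rw [Finset.HasAntidiagonal.mem_antidiagonal] at hp
    rw [coeff_detSubst_of_not_mem_range, zero_mul]
    dsimp only at hp ⊢
    have hX : degX m n p = 0 := by
      have := congrArg (degX m n) hp
      rw [map_add, degX, partDegree_single] at this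
      simp at this
      exact this.1
    rw [hX, Nat.pos_iff_ne_zero]
    intro hA
    apply hne
    have hp0 : p = 0 := by
      rw [degX_apply] at hX
      rw [degA_apply] at hA
      ext (i | j)
      · exact (Finset.sum_eq_zero_iff.1 hX) i (Finset.mem_univ _)
      · exact (Finset.sum_eq_zero_iff.1 hA) j (Finset.mem_univ _)
    rw [hp0, zero_add] at hp
    rw [hp0, hp]
  · intro h
    exact (h (by rw [Finset.HasAntidiagonal.mem_antidiagonal, zero_add])).elim

theorem exists_surjective_residues [IsLocalRing (DetR 𝕜 m n)] (hn : 2 ≤ n) (N : ℕ) :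
    ∃ (t : ℕ) (ρ : DetS 𝕜 m n →ₗ[DetR 𝕜 m n]
        (Fin N → IsLocalRing.ResidueField (DetR 𝕜 m n))),
      Function.Surjective ρ ∧
        basePowSubmodule (DetR 𝕜 m n) (detA 𝕜 m n) t ≤ LinearMap.ker ρ := by
  classical
  let ι : 𝕜 →+* IsLocalRing.ResidueField (DetR 𝕜 m n) :=
    (IsLocalRing.residue (DetR 𝕜 m n)).comp ((Ideal.Quotient.mk (detI2 𝕜 m n)).comp C)
  let a : Fin (n - 1) := ⟨0, by omega⟩
  let ρ : DetS 𝕜 m n →ₗ[DetR 𝕜 m n] (Fin N → IsLocalRing.ResidueField (DetR 𝕜 m n)) :=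
    { toFun := fun f s => ι (coeff (Finsupp.single (Sum.inr a) ((s : ℕ) + 1)) f)
      map_add' := fun f g => by
        ext s
        simp
      map_smul' := fun r f => by
        ext s
        obtain ⟨F, rfl⟩ := Ideal.Quotient.mk_surjective r
        rw [coeff_single_inr_smul, map_mul, RingHom.id_apply, Pi.smul_apply, Algebra.smul_def,
          IsLocalRing.ResidueField.algebraMap_eq, residue_mk]
        rfl }
  have hρ : ∀ f s, ρ f s = ι (coeff (Finsupp.single (Sum.inr a) ((s : ℕ) + 1)) f) :=
    fun _ _ => rfl
  have hA : ∀ k, degA m n (Finsupp.single (Sum.inr a) k) = k := by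
    intro k
    rw [degA, partDegree_single]
    simp
  have hX : ∀ k, degX m n (Finsupp.single (Sum.inr a) k) = 0 := by
    intro k
    rw [degX, partDegree_single]
    simp
  refine ⟨N + 1, ρ, ?_, sup_le ?_ ?_⟩
  · intro v
    have hι : Function.Surjective ι := by
      intro c
      obtain ⟨r, rfl⟩ := IsLocalRing.residue_surjective c
      obtain ⟨F, rfl⟩ := Ideal.Quotient.mk_surjective r
      exact ⟨constantCoeff F, (residue_mk F).symm⟩
    choose c hc using fun s => hι (v s)
    let f : DetS 𝕜 m n := ∑ s : Fin N, monomial (Finsupp.single (Sum.inr a) ((s : ℕ) + 1)) (c s)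
    refine ⟨f, ?_⟩
    ext s
    rw [hρ, map_sum, Finset.sum_eq_single s, coeff_monomial_same, hc]
    · intro u _ hne
      rw [coeff_monomial_ne]
      intro h
      apply hne
      have := congrArg (degA m n) h
      rw [hA, hA] at this
      exact Fin.ext (by omega)
    · exact fun h => (h (Finset.mem_univ _)).elim
  · rintro _ ⟨r, rfl⟩
    obtain ⟨F, rfl⟩ := Ideal.Quotient.mk_surjective r
    rw [LinearMap.mem_ker]
    ext s
    rw [hρ, Algebra.linearMap_apply, algebraMap_mk, coeff_detSubst_of_not_mem_range, map_zero,
      Pi.zero_apply]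
    rw [hA, hX]
    omega
  · intro f hf
    rw [Submodule.restrictScalars_mem, detA_pow] at hf
    rw [LinearMap.mem_ker]
    ext s
    rw [hρ, hf _ (by rw [hA]; omega), map_zero, Pi.zero_apply]

end residues

/-- for any canonical module `ω_R` of `R`, the socle
`Hom_R(𝕜, H^{m+n-2}_I(ω_R))` is an infinite-dimensional `𝕜`-vector space.  Since this
module is annihilated by `𝔪`, being infinite dimensional over `𝕜 = R/𝔪` is equivalent to
not being a finitely generated `R`-module. -/
theorem statement8 [IsLocalRing (DetR 𝕜 m n)] (hm : 2 ≤ m) (hn : 2 ≤ n)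
    (ω : ModuleCat (DetR 𝕜 m n)) (hω : IsCanonicalModule (DetR 𝕜 m n) (m + n - 1) ω) :
    ¬ Module.Finite (DetR 𝕜 m n)
      (IsLocalRing.ResidueField (DetR 𝕜 m n) →ₗ[DetR 𝕜 m n]
        ((localCohomology (detJ 𝕜 m n) (m + n - 2)).obj ω)) := by
  obtain ⟨hfin, hzero, ⟨e⟩⟩ := hω
  obtain ⟨p, hp⟩ : ∃ p, m + n - 2 = p + 1 := ⟨m + n - 3, by omega⟩
  have hp' : m + n - 1 = p + 1 + 1 := by omega
  rw [hp'] at hzero e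
  rw [hp]
  have hk : ∀ j, j ≠ p + 1 → Subsingleton
      (extTo ω (IsLocalRing.ResidueField (DetR 𝕜 m n)) (j + 1)) := by
    intro j hj
    obtain ⟨E, -⟩ := exists_ext_equiv ω j
    have := hzero (j + 1) (by omega)
    exact (E (ModuleCat.of _ (IsLocalRing.ResidueField (DetR 𝕜 m n)))).symm.toEquiv.subsingleton
  have hk' : Nonempty (extTo ω (IsLocalRing.ResidueField (DetR 𝕜 m n)) (p + 1 + 1) ≃ₗ[DetR 𝕜 m n]
      IsLocalRing.ResidueField (DetR 𝕜 m n)) := by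
    obtain ⟨E, -⟩ := exists_ext_equiv ω (p + 1)
    exact ⟨(E _).symm.trans e⟩
  have hS : ∀ t j, p + 1 ≤ j → Subsingleton (extTo ω
      (DetS 𝕜 m n ⧸ powSubmodule (DetR 𝕜 m n) (detA 𝕜 m n) t) j) := fun t j hj =>
    extTo_quotient_powSubmodule_subsingleton hn (p + 1 + 1) (fun i hi => by
      obtain ⟨i, rfl⟩ := Nat.exists_eq_succ_of_ne_zero (show i ≠ 0 by omega)
      exact hk i (by omega)) t j (by omega)
  exact localCohomology_socle_not_finite p comap_detA_pow (hk p (by omega)) hk'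
    (fun t => hS t _ le_rfl) (fun t => hS t _ (by omega))
    (isFiniteLength_quotient_basePowSubmodule hn) (exists_surjective_residues hn)
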